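/- arXiv:2108.00263 — 2 statements merged into one kernel-verified Lean document; each statement's English description precedes it below -/
import Mathlib

section
/- Under Assumption (A), suppose d ≤ γn where γ = c·(m/M ∧ m²/(L·√M))² for a small enough absolute constant c > 0, and let f ∈ C^s with s = k+1+ρ for an integer k ≥ 1 and ρ ∈ (0,1]. Then there is a constant C depending only on M, L, m, s such that for all θ ∈ ℝ^d: | E_θ f_k(θ̂) − f(θ) | ≤ C·‖f‖_{C^s}·(√(d/n))^s. -/
open MeasureTheory Real
open scoped RealInnerProductSpace BigOperators ENNReal NNReal

noncomputable section

abbrev Euc (d : ℕ) : Type := EuclideanSpace ℝ (Fin d)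

/-- The noise distribution with density `e^{-V(x)}` w.r.t. Lebesgue measure. -/
def noiseMeasure {d : ℕ} (V : Euc d → ℝ) : Measure (Euc d) :=
  MeasureTheory.volume.withDensity fun x => ENNReal.ofReal (Real.exp (-(V x)))

/-- The joint distribution of an i.i.d. sample `X_1, …, X_n` from `P_θ(dx) = e^{-V(x-θ)}dx`. -/
def sampleMeasure {d : ℕ} (V : Euc d → ℝ) (n : ℕ) (θ : Euc d) : Measure (Fin n → Euc d) :=
  Measure.pi fun _ => (noiseMeasure V).map (fun x => θ + x)

/-- `ψ_α`-norm of a random variable: `sup_{p ≥ 1} p^{-1/α} (E|η|^p)^{1/p}`. -/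
def psiNorm {Ω : Type*} [MeasurableSpace Ω] (α : ℝ) (μ : Measure Ω) (η : Ω → ℝ) : ℝ :=
  ⨆ p : {p : ℝ // 1 ≤ p}, (p : ℝ) ^ (-(1 / α)) * (∫ ω, |η ω| ^ (p : ℝ) ∂μ) ^ ((1 : ℝ) / (p : ℝ))

/-- `f` belongs to the Hölder ball of radius `B` in `C^s`, `s = l + ρ`. -/
def holderCLe {d : ℕ} (l : ℕ) (ρ : ℝ) (f : Euc d → ℝ) (B : ℝ) : Prop :=
  ContDiff ℝ l f ∧
  (∀ j : ℕ, j ≤ l → ∀ x, ‖iteratedFDeriv ℝ j f x‖ ≤ B) ∧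
  (∀ x y, ‖iteratedFDeriv ℝ l f x - iteratedFDeriv ℝ l f y‖ ≤ B * ‖x - y‖ ^ ρ)

/-- The operator `(T g)(θ) = E_θ g(θ̂)`. -/
def Texp {d : ℕ} (V : Euc d → ℝ) (n : ℕ) (hatθ : (Fin n → Euc d) → Euc d) (g : Euc d → ℝ) :
    Euc d → ℝ :=
  fun θ => ∫ x, g (hatθ x) ∂ sampleMeasure V n θ

/-- The operator `𝓑 = 𝓣 - Id`. -/
def Bop {d : ℕ} (V : Euc d → ℝ) (n : ℕ) (hatθ : (Fin n → Euc d) → Euc d) :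
    (Euc d → ℝ) → Euc d → ℝ :=
  fun g θ => Texp V n hatθ g θ - g θ

/-- The bias-corrected functional `f_k = Σ_{j=0}^k (-1)^j 𝓑^j f`. -/
def biasCorrect {d : ℕ} (V : Euc d → ℝ) (n : ℕ) (hatθ : (Fin n → Euc d) → Euc d) (k : ℕ)
    (f : Euc d → ℝ) : Euc d → ℝ :=
  fun θ => ∑ j ∈ Finset.range (k + 1), (-1 : ℝ) ^ j * (Bop V n hatθ)^[j] f θ

/-- The Poincaré constant `c(V)` of the distribution `e^{-V(x)}dx`. -/
def poincareConst {d : ℕ} (V : Euc d → ℝ) : ℝ :=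
  sInf {C : ℝ | 0 ≤ C ∧ ∀ g : Euc d → ℝ, LocallyLipschitz g →
    ∫ x, (g x - ∫ y, g y ∂ noiseMeasure V) ^ 2 ∂ noiseMeasure V ≤
      C * ∫ x, ‖gradient g x‖ ^ 2 ∂ noiseMeasure V}

/-- The finite differences of order `j` of `g` are at most `A * ∏ i, min 1 ‖h i‖`. -/
def DiffBound {E : Type*} [NormedAddCommGroup E] : ℕ → ℝ → (E → ℝ) → Prop
  | 0, A, g => ∀ x, |g x| ≤ A
  | j + 1, A, g => ∀ h, DiffBound j (A * min 1 ‖h‖) (fun x => g (x + h) - g x)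

/-- `g` is of class `C^l`, and its derivatives up to order `l` are bounded by `A`. -/
structure DerivBound {E : Type*} [NormedAddCommGroup E] [NormedSpace ℝ E]
    (l : ℕ) (A : ℝ) (g : E → ℝ) : Prop where
  contDiff : ContDiff ℝ l g
  bound : ∀ j ≤ l, ∀ x, ‖iteratedFDeriv ℝ j g x‖ ≤ A

section Differences

variable {E : Type*} [NormedAddCommGroup E] {Ω : Type*} [MeasurableSpace Ω]

theorem DiffBound.integral {P : Measure Ω} {j : ℕ} :
    ∀ {a : Ω → ℝ} {G : Ω → E → ℝ}, Integrable a P → (∀ x, Integrable (fun ω => G ω x) P) →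
      (∀ᵐ ω ∂P, DiffBound j (a ω) (G ω)) → DiffBound j (∫ ω, a ω ∂P) (fun x => ∫ ω, G ω x ∂P) := by
  induction j with
  | zero =>
    intro a G ha hG h x
    exact norm_integral_le_of_norm_le (f := fun ω => G ω x) ha (h.mono fun ω hω => hω x)
  | succ j ih =>
    intro a G ha hG h v
    rw [← integral_mul_const]
    have := ih (ha.mul_const (min 1 ‖v‖)) (fun x => (hG (x + v)).sub (hG x)) (h.mono fun ω hω => hω v)
    convert this using 2 with x
    exact (integral_sub (hG _) (hG _)).symm

theorem DiffBound.add {j : ℕ} :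
    ∀ {A A' : ℝ} {g g' : E → ℝ}, DiffBound j A g → DiffBound j A' g' →
      DiffBound j (A + A') (fun x => g x + g' x) := by
  induction j with
  | zero =>
    intro A A' g g' h h' x
    exact (abs_add_le _ _).trans (add_le_add (h x) (h' x))
  | succ j ih =>
    intro A A' g g' h h' v
    rw [add_mul]
    convert ih (h v) (h' v) using 2 with x
    ring

theorem DiffBound.mono {j : ℕ} :
    ∀ {A A' : ℝ} {g : E → ℝ}, DiffBound j A g → A ≤ A' → DiffBound j A' g := by
  induction j with
  | zero => exact fun h hA x => (h x).trans hA
  | succ j ih =>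
    exact fun h hA v => ih (h v) (mul_le_mul_of_nonneg_right hA (by positivity))

variable [NormedSpace ℝ E]

theorem iteratedFDeriv_diff {l j : ℕ} {g : E → ℝ} (hg : ContDiff ℝ l g) (hj : j ≤ l) (h x : E) :
    iteratedFDeriv ℝ j (fun y => g (y + h) - g y) x =
      iteratedFDeriv ℝ j g (x + h) - iteratedFDeriv ℝ j g x := by
  have hg' : ContDiff ℝ j g := hg.of_le (by exact_mod_cast hj)
  have h1 : ContDiff ℝ j (fun y => g (y + h)) := hg'.comp (contDiff_id.add contDiff_const)
  rw [← iteratedFDeriv_comp_add_right]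
  exact iteratedFDeriv_sub_apply h1.contDiffAt hg'.contDiffAt

theorem norm_iteratedFDeriv_sub_le {l j : ℕ} {A : ℝ} {g : E → ℝ} (hg : DerivBound l A g)
    (hj : j < l) (x y : E) :
    ‖iteratedFDeriv ℝ j g x - iteratedFDeriv ℝ j g y‖ ≤ A * ‖x - y‖ := by
  refine Convex.norm_image_sub_le_of_norm_fderiv_le (𝕜 := ℝ) (s := Set.univ) ?_ ?_ convex_univ
    (Set.mem_univ y) (Set.mem_univ x)
  · exact fun z _ => (hg.contDiff.differentiable_iteratedFDeriv (by exact_mod_cast hj)) z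
  · intro z _
    rw [norm_fderiv_iteratedFDeriv]
    exact hg.bound _ hj z

theorem ContDiff.diff {l : ℕ} {g : E → ℝ} (hg : ContDiff ℝ l g) (h : E) :
    ContDiff ℝ l (fun y => g (y + h) - g y) :=
  (hg.comp (contDiff_id.add contDiff_const)).sub hg

theorem DerivBound.diff {l : ℕ} {A : ℝ} {g : E → ℝ} (hg : DerivBound (l + 1) A g) (h : E) :
    DerivBound l (2 * A * min 1 ‖h‖) (fun y => g (y + h) - g y) where
  contDiff := (hg.contDiff.of_le (by exact_mod_cast Nat.le_succ l)).diff h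
  bound j hj x := by
    rw [iteratedFDeriv_diff hg.contDiff (hj.trans (Nat.le_succ l))]
    have hA : 0 ≤ A := (norm_nonneg _).trans (hg.bound 0 (Nat.zero_le _) 0)
    have h1 := norm_iteratedFDeriv_sub_le hg (Nat.lt_succ_of_le hj) (x + h) x
    rw [add_sub_cancel_left] at h1
    have h2 := norm_sub_le_of_le (hg.bound j (hj.trans (Nat.le_succ l)) (x + h))
      (hg.bound j (hj.trans (Nat.le_succ l)) x)
    rcases min_choice 1 ‖h‖ with h3 | h3 <;> rw [h3]
    · linarith
    · nlinarith [norm_nonneg h]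

theorem DerivBound.diffBound {l : ℕ} :
    ∀ {A : ℝ} {g : E → ℝ}, DerivBound l A g → DiffBound l (2 ^ l * A) g := by
  induction l with
  | zero =>
    intro A g hg x
    simpa using hg.bound 0 le_rfl x
  | succ l ih =>
    intro A g hg h
    convert ih (hg.diff h) using 1
    ring

theorem DerivBound.fderiv_apply {l : ℕ} {A : ℝ} {g : E → ℝ} (hg : DerivBound (l + 1) A g)
    (h : E) : DerivBound l (A * ‖h‖) (fun x => fderiv ℝ g x h) := by
  have hd : ContDiff ℝ l (fderiv ℝ g) := hg.contDiff.fderiv_right (by norm_cast)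
  refine ⟨hd.clm_apply contDiff_const, fun j hj x => ?_⟩
  refine (norm_iteratedFDeriv_clm_apply_const (N := l) hd.contDiffAt (by exact_mod_cast hj)).trans ?_
  rw [norm_iteratedFDeriv_fderiv, mul_comm]
  exact mul_le_mul_of_nonneg_right (hg.bound _ (by omega) x) (norm_nonneg _)

end Differences

section Taylor

variable {d : ℕ}

theorem holderCLe.derivBound {l : ℕ} {ρ B : ℝ} {f : Euc d → ℝ} (hf : holderCLe l ρ f B) :
    DerivBound l B f := ⟨hf.1, hf.2.1⟩

theorem holderCLe.nonneg {l : ℕ} {ρ B : ℝ} {f : Euc d → ℝ} (hf : holderCLe l ρ f B) : 0 ≤ B :=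
  (norm_nonneg _).trans (hf.2.1 0 (Nat.zero_le _) 0)

theorem holderCLe.derivBound_diff {l : ℕ} {ρ B : ℝ} {f : Euc d → ℝ} (hf : holderCLe l ρ f B)
    (hρ : 0 < ρ) (hρ1 : ρ ≤ 1) (v : Euc d) :
    DerivBound l (2 * B * ‖v‖ ^ ρ) (fun x => f (x + v) - f x) where
  contDiff := hf.1.diff v
  bound j hj x := by
    have hB := hf.nonneg
    rw [iteratedFDeriv_diff hf.1 hj]
    have hv : 0 ≤ ‖v‖ ^ ρ := by positivity
    rcases hj.lt_or_eq with hj' | rfl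
    · rcases le_total ‖v‖ 1 with h1 | h1
      · have h2 := norm_iteratedFDeriv_sub_le hf.derivBound hj' (x + v) x
        rw [add_sub_cancel_left] at h2
        have h3 : ‖v‖ ≤ ‖v‖ ^ ρ := Real.self_le_rpow_of_le_one (norm_nonneg _) h1 hρ1
        nlinarith [mul_le_mul_of_nonneg_left h3 hB, mul_nonneg hB hv]
      · have h2 := norm_sub_le_of_le (hf.2.1 j hj (x + v)) (hf.2.1 j hj x)
        have h3 : 1 ≤ ‖v‖ ^ ρ := Real.one_le_rpow h1 hρ.le
        nlinarith
    · have h2 := hf.2.2 (x + v) x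
      rw [add_sub_cancel_left] at h2
      nlinarith [mul_nonneg hB hv]

theorem holderCLe.diffBound_taylor {k : ℕ} {ρ B : ℝ} {f : Euc d → ℝ}
    (hf : holderCLe (k + 1) ρ f B) (hρ : 0 < ρ) (hρ1 : ρ ≤ 1) (h : Euc d) :
    DiffBound k (2 ^ (k + 1) * B * (‖h‖ * ‖h‖ ^ ρ))
      (fun x => f (x + h) - f x - fderiv ℝ f x h) := by
  have hB := hf.nonneg
  have hdiff : Differentiable ℝ f := hf.1.differentiable (by norm_cast)
  have hcont : Continuous (fderiv ℝ f) := hf.1.continuous_fderiv (by norm_cast)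
  have hc : ∀ x, Continuous fun t : ℝ => fderiv ℝ f (x + t • h) h - fderiv ℝ f x h := fun x => by
    fun_prop
  have hint : ∀ x, f (x + h) - f x - fderiv ℝ f x h =
      ∫ t in Set.Ioc (0 : ℝ) 1, (fderiv ℝ f (x + t • h) h - fderiv ℝ f x h) := by
    intro x
    have hderiv : ∀ t ∈ Set.uIcc (0 : ℝ) 1,
        HasDerivAt (fun t : ℝ => f (x + t • h) - t * fderiv ℝ f x h)
          (fderiv ℝ f (x + t • h) h - fderiv ℝ f x h) t := by
      intro t _
      have h1 : HasDerivAt (fun t : ℝ => x + t • h) h t := by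
        simpa using ((hasDerivAt_id t).smul_const h).const_add x
      have h2 := (hdiff (x + t • h)).hasFDerivAt.comp_hasDerivAt t h1
      have h3 := h2.sub ((hasDerivAt_id' t).mul_const (fderiv ℝ f x h))
      rw [one_mul] at h3
      exact h3
    have := intervalIntegral.integral_eq_sub_of_hasDerivAt hderiv
      ((hc x).intervalIntegrable 0 1)
    rw [intervalIntegral.integral_of_le zero_le_one] at this
    rw [this]
    simp
    ring
  have key : DiffBound k (∫ _t in Set.Ioc (0 : ℝ) 1, 2 ^ (k + 1) * B * (‖h‖ * ‖h‖ ^ ρ))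
      (fun x => ∫ t in Set.Ioc (0 : ℝ) 1, (fderiv ℝ f (x + t • h) h - fderiv ℝ f x h)) := by
    refine DiffBound.integral (integrable_const _) (fun x => ?_) ?_
    · exact ((hc x).integrableOn_Icc).mono_set Set.Ioc_subset_Icc_self
    · filter_upwards [ae_restrict_mem measurableSet_Ioc] with t ht
      have h1 := ((hf.derivBound_diff hρ hρ1 (t • h)).fderiv_apply h).diffBound
      have h2 : ∀ x, fderiv ℝ (fun y => f (y + t • h) - f y) x h =
          fderiv ℝ f (x + t • h) h - fderiv ℝ f x h := by
        intro x
        rw [fderiv_fun_sub ((differentiableAt_comp_add_right _).2 (hdiff _)) (hdiff x), fderiv_comp_add_right]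
        rfl
      simp only [h2] at h1
      refine h1.mono ?_
      have h3 : ‖t • h‖ ^ ρ ≤ ‖h‖ ^ ρ := by
        refine Real.rpow_le_rpow (norm_nonneg _) ?_ hρ.le
        rw [norm_smul, Real.norm_of_nonneg ht.1.le]
        exact mul_le_of_le_one_left (norm_nonneg _) ht.2
      calc (2 : ℝ) ^ k * (2 * B * ‖t • h‖ ^ ρ * ‖h‖) ≤ 2 ^ k * (2 * B * ‖h‖ ^ ρ * ‖h‖) := by gcongr
        _ = _ := by ring
  simp only [← hint] at key
  simpa using key

end Taylor

section BiasOperator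

variable {d : ℕ} {Ω : Type*} [MeasurableSpace Ω]

/-- The bias operator of the random shift `T`. -/
def shiftBias (P : Measure Ω) (T : Ω → Euc d) (g : Euc d → ℝ) : Euc d → ℝ :=
  fun x => ∫ ω, (g (x + T ω) - g x) ∂P

variable {P : Measure Ω} [IsProbabilityMeasure P] {T : Ω → Euc d}

theorem integrable_comp_shift (hT : Measurable T) {g : Euc d → ℝ} {A : ℝ} (hg : Continuous g)
    (hA : ∀ x, |g x| ≤ A) (x : Euc d) : Integrable (fun ω => g (x + T ω)) P :=
  Integrable.of_bound (hg.measurable.comp (hT.const_add x)).aestronglyMeasurable A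
    (ae_of_all _ fun _ => hA _)

theorem shiftBias_eq (hT : Measurable T) {g : Euc d → ℝ} {A : ℝ} (hg : Continuous g)
    (hA : ∀ x, |g x| ≤ A) (x : Euc d) :
    shiftBias P T g x = (∫ ω, g (x + T ω) ∂P) - g x := by
  rw [shiftBias, integral_sub (integrable_comp_shift hT hg hA x) (integrable_const _)]
  simp

theorem continuous_shiftBias (hT : Measurable T) {g : Euc d → ℝ} {A : ℝ} (hg : Continuous g)
    (hA : ∀ x, |g x| ≤ A) : Continuous (shiftBias P T g) := by
  refine continuous_of_dominated (bound := fun _ => A + A) (fun x => ?_) (fun x => ?_)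
    (integrable_const _) (ae_of_all _ fun ω => by fun_prop)
  · exact ((integrable_comp_shift hT hg hA x).sub (integrable_const _)).aestronglyMeasurable
  · exact ae_of_all _ fun ω => norm_sub_le_of_le (hA _) (hA _)

theorem abs_shiftBias_le {g : Euc d → ℝ} {A : ℝ}
    (hA : ∀ x, |g x| ≤ A) (x : Euc d) : |shiftBias P T g x| ≤ A + A := by
  have := norm_integral_le_of_norm_le (μ := P) (f := fun ω => g (x + T ω) - g x)
    (integrable_const (A + A)) (ae_of_all _ fun ω => norm_sub_le_of_le (hA _) (hA _))
  simpa [shiftBias] using this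

theorem continuous_iterate_shiftBias (hT : Measurable T) (j : ℕ) :
    ∀ {g : Euc d → ℝ} {A : ℝ}, Continuous g → (∀ x, |g x| ≤ A) →
      Continuous ((shiftBias P T)^[j] g) ∧ ∀ x, |(shiftBias P T)^[j] g x| ≤ 2 ^ j * A := by
  induction j with
  | zero => exact fun hg hA => ⟨hg, by simpa using hA⟩
  | succ j ih =>
    intro g A hg hA
    have := ih (continuous_shiftBias (P := P) hT hg hA) (abs_shiftBias_le hA)
    refine ⟨this.1, fun x => (this.2 x).trans (le_of_eq ?_)⟩
    ring

theorem integrable_min_norm (hT : Measurable T) : Integrable (fun ω => min 1 ‖T ω‖) P :=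
  Integrable.of_bound (measurable_const.min hT.norm).aestronglyMeasurable 1
    (ae_of_all _ fun ω => by
      rw [Real.norm_of_nonneg (by positivity)]
      exact min_le_left _ _)

theorem DiffBound.shiftBias (hT : Measurable T) {j : ℕ} {g : Euc d → ℝ} {A A' : ℝ}
    (hg : Continuous g) (hA : ∀ x, |g x| ≤ A) (h : DiffBound (j + 1) A' g) :
    DiffBound j (A' * ∫ ω, min 1 ‖T ω‖ ∂P) (shiftBias P T g) := by
  rw [← integral_const_mul]
  exact DiffBound.integral ((integrable_min_norm hT).const_mul _)
    (fun x => (integrable_comp_shift hT hg hA x).sub (integrable_const _))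
    (ae_of_all _ fun ω => h (T ω))

theorem abs_iterate_shiftBias_le (hT : Measurable T) {j : ℕ} :
    ∀ {g : Euc d → ℝ} {A A' : ℝ}, Continuous g → (∀ x, |g x| ≤ A) → DiffBound j A' g →
      ∀ x, |(_root_.shiftBias P T)^[j] g x| ≤ A' * (∫ ω, min 1 ‖T ω‖ ∂P) ^ j := by
  induction j with
  | zero => exact fun _ _ h x => by simpa using h x
  | succ j ih =>
    intro g A A' hg hA h x
    rw [pow_succ', ← mul_assoc]
    exact ih (continuous_shiftBias hT hg hA) (abs_shiftBias_le hA) (h.shiftBias hT hg hA) x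

end BiasOperator

section BiasBound

theorem mul_rpow_le_one_add_sq {u ρ : ℝ} (hu : 0 ≤ u) (hρ : 0 < ρ) (hρ1 : ρ ≤ 1) :
    u * u ^ ρ ≤ 1 + u ^ 2 := by
  rcases le_total u 1 with h | h
  · have := Real.rpow_le_one hu h hρ.le
    nlinarith [Real.rpow_nonneg hu ρ]
  · have : u ^ ρ ≤ u ^ (1 : ℝ) := Real.rpow_le_rpow_of_exponent_le h hρ1
    rw [Real.rpow_one] at this
    nlinarith

theorem mul_rpow_le_of_pos {t a ρ : ℝ} (ht : 0 ≤ t) (ha : 0 < a) (hρ : 0 < ρ) (hρ1 : ρ ≤ 1) :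
    t * t ^ ρ ≤ a * a ^ ρ * (1 + t ^ 2 / a ^ 2) := by
  have h := mul_rpow_le_one_add_sq (div_nonneg ht ha.le) hρ hρ1
  have h1 : t * t ^ ρ = a * a ^ ρ * (t / a * (t / a) ^ ρ) := by
    rw [Real.div_rpow ht ha.le]
    have : a ^ ρ ≠ 0 := (Real.rpow_pos_of_pos ha ρ).ne'
    field_simp
  rw [h1, ← div_pow]
  gcongr

variable {d : ℕ} {Ω : Type*} [MeasurableSpace Ω] {P : Measure Ω} [IsProbabilityMeasure P]
  {T : Ω → Euc d}

theorem integrableOn_norm_pow_of_bound (hT : Measurable T) {good : Set Ω} (hg : MeasurableSet good)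
    {R : ℝ} (hR : ∀ ω ∈ good, ‖T ω‖ ≤ R) (p : ℕ) :
    Integrable (fun ω => ‖T ω‖ ^ p) (P.restrict good) := by
  refine Integrable.of_bound (hT.norm.pow_const p).aestronglyMeasurable (R ^ p) ?_
  filter_upwards [ae_restrict_mem hg] with ω hω
  rw [norm_pow, norm_norm]
  exact pow_le_pow_left₀ (norm_nonneg _) (hR ω hω) p

theorem setIntegral_one_add_sq_le (hT : Measurable T) {good : Set Ω} (hg : MeasurableSet good)
    {R K δ : ℝ} (hδ : 0 < δ) (hR : ∀ ω ∈ good, ‖T ω‖ ≤ R)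
    (h2 : ∫ ω in good, ‖T ω‖ ^ 2 ∂P ≤ K * δ) :
    ∫ ω in good, (1 + ‖T ω‖ ^ 2 / √δ ^ 2) ∂P ≤ 1 + K := by
  rw [integral_add (integrable_const _)
    ((integrableOn_norm_pow_of_bound hT hg hR 2).div_const _), integral_div, Real.sq_sqrt hδ.le]
  have h3 : P.real good ≤ 1 := measureReal_le_one
  have h4 : (∫ ω in good, ‖T ω‖ ^ 2 ∂P) / δ ≤ K := by rwa [div_le_iff₀ hδ]
  simp only [integral_const, smul_eq_mul, mul_one, measureReal_restrict_apply_univ]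
  linarith

theorem integral_min_norm_le (hT : Measurable T) {good : Set Ω} (hg : MeasurableSet good)
    {R K δ : ℝ} (hδ : 0 < δ) (hδ1 : δ ≤ 1) (hK : 0 ≤ K) (hbad : P.real goodᶜ ≤ K * δ)
    (hR : ∀ ω ∈ good, ‖T ω‖ ≤ R) (h2 : ∫ ω in good, ‖T ω‖ ^ 2 ∂P ≤ K * δ) :
    ∫ ω, min 1 ‖T ω‖ ∂P ≤ (2 * K + 1) * √δ := by
  have hs : 0 < √δ := Real.sqrt_pos.2 hδ
  have hs1 : √δ ≤ 1 := Real.sqrt_le_one.2 hδ1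
  have hss : √δ ^ 2 = δ := Real.sq_sqrt hδ.le
  rw [← integral_add_compl hg (integrable_min_norm hT)]
  have i1 : ∫ ω in good, min 1 ‖T ω‖ ∂P ≤ √δ * (1 + K) := by
    refine le_trans ?_ (mul_le_mul_of_nonneg_left
      (setIntegral_one_add_sq_le hT hg hδ hR h2) hs.le)
    rw [← integral_const_mul]
    refine integral_mono (integrable_min_norm hT).integrableOn
      (((integrable_const _).add ((integrableOn_norm_pow_of_bound hT hg hR 2).div_const _)).const_mul
        _) fun ω => (min_le_right _ _).trans ?_
    have : 0 ≤ (‖T ω‖ - √δ) ^ 2 / √δ := by positivity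
    have h3 : √δ * (1 + ‖T ω‖ ^ 2 / √δ ^ 2) = (‖T ω‖ - √δ) ^ 2 / √δ + 2 * ‖T ω‖ := by
      field_simp
      ring
    change _ ≤ √δ * (1 + ‖T ω‖ ^ 2 / √δ ^ 2)
    rw [h3]
    linarith [norm_nonneg (T ω)]
  have i2 : ∫ ω in goodᶜ, min 1 ‖T ω‖ ∂P ≤ K * δ := by
    refine le_trans ?_ hbad
    refine (integral_mono (integrable_min_norm hT).integrableOn (integrable_const (1 : ℝ))
      fun ω => min_le_left _ _).trans ?_
    simp
  have i3 : δ ≤ √δ := by nlinarith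
  nlinarith [mul_le_mul_of_nonneg_left i3 hK]

theorem diffBound_shiftBias {k : ℕ} {ρ B : ℝ} {f : Euc d → ℝ} (hf : holderCLe (k + 1) ρ f B)
    (hρ : 0 < ρ) (hρ1 : ρ ≤ 1) (hT : Measurable T) {good : Set Ω} (hg : MeasurableSet good)
    {R K δ : ℝ} (hδ : 0 < δ) (hδ1 : δ ≤ 1) (hK : 0 ≤ K) (hbad : P.real goodᶜ ≤ K * δ)
    (hR : ∀ ω ∈ good, ‖T ω‖ ≤ R) (h2 : ∫ ω in good, ‖T ω‖ ^ 2 ∂P ≤ K * δ)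
    (h1 : ‖∫ ω in good, T ω ∂P‖ ≤ K * δ) :
    DiffBound k (2 ^ (k + 1) * B * (3 * K + 1) * (√δ * √δ ^ ρ)) (shiftBias P T f) := by
  have hB := hf.nonneg
  have hs : 0 < √δ := Real.sqrt_pos.2 hδ
  have hs1 : √δ ≤ 1 := Real.sqrt_le_one.2 hδ1
  have hss : √δ * √δ = δ := Real.mul_self_sqrt hδ.le
  have hδρ : δ ≤ √δ * √δ ^ ρ := by
    calc δ = √δ * √δ := hss.symm
      _ ≤ √δ * √δ ^ ρ :=
        mul_le_mul_of_nonneg_left (Real.self_le_rpow_of_le_one hs.le hs1 hρ1) hs.le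
  have hfc : Continuous f := hf.1.continuous
  have hf'c : Continuous (fderiv ℝ f) := hf.1.continuous_fderiv (by norm_cast)
  have hfb : ∀ x, |f x| ≤ B := fun x => by simpa using hf.2.1 0 (Nat.zero_le _) x
  have hint : ∀ x, Integrable (fun ω => f (x + T ω) - f x) P := fun x =>
    (integrable_comp_shift hT hfc hfb x).sub (integrable_const _)
  have hTint : Integrable T (P.restrict good) := by
    have := integrableOn_norm_pow_of_bound (P := P) hT hg hR 1
    simp only [pow_one] at this
    exact (integrable_norm_iff hT.aestronglyMeasurable).1 this
  have I1 : DiffBound k (2 ^ (k + 1) * B * (√δ * √δ ^ ρ) * K)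
      (fun x => ∫ ω in goodᶜ, (f (x + T ω) - f x) ∂P) := by
    have := DiffBound.integral (P := P.restrict goodᶜ) (j := k)
      (integrable_const (2 ^ (k + 1) * B)) (fun x => (hint x).integrableOn) (ae_of_all _ fun ω =>
        ((hf.derivBound.diff (T ω)).diffBound).mono (A' := 2 ^ (k + 1) * B) (by
          rw [pow_succ, mul_assoc, mul_assoc]
          gcongr
          exact mul_le_of_le_one_right (by positivity) (min_le_left _ _)))
    refine this.mono ?_
    simp only [integral_const, smul_eq_mul, measureReal_restrict_apply_univ]
    calc P.real goodᶜ * (2 ^ (k + 1) * B) ≤ K * δ * (2 ^ (k + 1) * B) := by gcongr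
      _ ≤ K * (√δ * √δ ^ ρ) * (2 ^ (k + 1) * B) := by gcongr
      _ = _ := by ring
  have hRint : ∀ x, Integrable (fun ω => f (x + T ω) - f x - fderiv ℝ f x (T ω))
      (P.restrict good) := fun x =>
    (hint x).integrableOn.sub ((fderiv ℝ f x).integrable_comp hTint)
  have I2 : DiffBound k (2 ^ (k + 1) * B * (√δ * √δ ^ ρ) * (1 + K))
      (fun x => ∫ ω in good, (f (x + T ω) - f x - fderiv ℝ f x (T ω)) ∂P) := by
    have := DiffBound.integral (P := P.restrict good) (j := k)
      (((integrable_const (1 : ℝ)).add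
        ((integrableOn_norm_pow_of_bound hT hg hR 2).div_const (√δ ^ 2))).const_mul
          (2 ^ (k + 1) * B * (√δ * √δ ^ ρ))) hRint (ae_of_all _ fun ω =>
        (hf.diffBound_taylor hρ hρ1 (T ω)).mono (by
          rw [mul_assoc (2 ^ (k + 1) * B)]
          exact mul_le_mul_of_nonneg_left (mul_rpow_le_of_pos (norm_nonneg _) hs hρ hρ1)
            (by positivity)))
    refine this.mono ?_
    rw [integral_const_mul]
    gcongr
    exact setIntegral_one_add_sq_le hT hg hδ hR h2
  have I3 : DiffBound k (2 ^ (k + 1) * B * (√δ * √δ ^ ρ) * K)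
      (fun x => fderiv ℝ f x (∫ ω in good, T ω ∂P)) := by
    refine ((hf.derivBound.fderiv_apply _).diffBound).mono ?_
    calc 2 ^ k * (B * ‖∫ ω in good, T ω ∂P‖) ≤ 2 ^ (k + 1) * (B * (K * (√δ * √δ ^ ρ))) := by
          gcongr
          · norm_num
          · omega
          · exact h1.trans (by gcongr)
      _ = _ := by ring
  have hsum := (I1.add I2).add I3
  have heq : shiftBias P T f = fun x => ∫ ω in goodᶜ, (f (x + T ω) - f x) ∂P +
      ∫ ω in good, (f (x + T ω) - f x - fderiv ℝ f x (T ω)) ∂P +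
      fderiv ℝ f x (∫ ω in good, T ω ∂P) := by
    funext x
    rw [integral_sub (hint x).integrableOn ((fderiv ℝ f x).integrable_comp hTint),
      (fderiv ℝ f x).integral_comp_comm hTint, shiftBias, ← integral_add_compl hg (hint x)]
    ring
  rw [heq]
  convert hsum using 1
  ring

theorem abs_iterate_shiftBias_le_of_holder {k : ℕ} {ρ B : ℝ} {f : Euc d → ℝ}
    (hf : holderCLe (k + 1) ρ f B)
    (hρ : 0 < ρ) (hρ1 : ρ ≤ 1) (hT : Measurable T) {good : Set Ω} (hg : MeasurableSet good)
    {R K δ : ℝ} (hδ : 0 < δ) (hδ1 : δ ≤ 1) (hK : 0 ≤ K) (hbad : P.real goodᶜ ≤ K * δ)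
    (hR : ∀ ω ∈ good, ‖T ω‖ ≤ R) (h2 : ∫ ω in good, ‖T ω‖ ^ 2 ∂P ≤ K * δ)
    (h1 : ‖∫ ω in good, T ω ∂P‖ ≤ K * δ) (x : Euc d) :
    |(shiftBias P T)^[k + 1] f x| ≤
      2 ^ (k + 1) * (3 * K + 1) * (2 * K + 1) ^ k * B * √δ ^ ((k : ℝ) + 1 + ρ) := by
  have hB := hf.nonneg
  have hs : 0 < √δ := Real.sqrt_pos.2 hδ
  have hfc : Continuous f := hf.1.continuous
  have hfb : ∀ x, |f x| ≤ B := fun x => by simpa using hf.2.1 0 (Nat.zero_le _) x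
  rw [Function.iterate_succ_apply]
  refine (abs_iterate_shiftBias_le hT (continuous_shiftBias hT hfc hfb) (abs_shiftBias_le hfb)
    (diffBound_shiftBias hf hρ hρ1 hT hg hδ hδ1 hK hbad hR h2 h1) x).trans ?_
  have h3 : (∫ ω, min 1 ‖T ω‖ ∂P) ^ k ≤ ((2 * K + 1) * √δ) ^ k :=
    pow_le_pow_left₀ (integral_nonneg fun ω => by positivity)
      (integral_min_norm_le hT hg hδ hδ1 hK hbad hR h2) k
  rw [Real.rpow_add hs, Real.rpow_add hs, Real.rpow_one, Real.rpow_natCast]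
  calc _ ≤ 2 ^ (k + 1) * B * (3 * K + 1) * (√δ * √δ ^ ρ) * ((2 * K + 1) * √δ) ^ k := by gcongr
    _ = _ := by rw [mul_pow]; ring

end BiasBound

section Minimizer

variable {d n : ℕ} {V : Euc d → ℝ} {hatθ : (Fin n → Euc d) → Euc d}

theorem strictConvexOn_sum_translate (hn : 0 < n) (hV : StrictConvexOn ℝ Set.univ V)
    (x : Fin n → Euc d) : StrictConvexOn ℝ Set.univ (fun t => ∑ j, V (x j - t)) := by
  refine ⟨convex_univ, fun a _ b _ hab s t hs ht hst => ?_⟩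
  have : Nonempty (Fin n) := ⟨⟨0, hn⟩⟩
  simp only [Finset.smul_sum, ← Finset.sum_add_distrib]
  refine Finset.sum_lt_sum_of_nonempty Finset.univ_nonempty fun j _ => ?_
  have h := hV.2 (Set.mem_univ (x j - a)) (Set.mem_univ (x j - b))
    (fun h => hab (sub_right_injective h)) hs ht hst
  convert h using 2
  calc x j - (s • a + t • b) = (s + t) • x j - (s • a + t • b) := by rw [hst, one_smul]
    _ = _ := by module

theorem minimizer_unique (hn : 0 < n) (hV : StrictConvexOn ℝ Set.univ V)
    {x : Fin n → Euc d} {a b : Euc d} (ha : ∀ t, ∑ j, V (x j - a) ≤ ∑ j, V (x j - t))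
    (hb : ∀ t, ∑ j, V (x j - b) ≤ ∑ j, V (x j - t)) : a = b :=
  (strictConvexOn_sum_translate hn hV x).eq_of_isMinOn (fun t _ => ha t) (fun t _ => hb t)
    (Set.mem_univ _) (Set.mem_univ _)

theorem minimizer_add (hn : 0 < n) (hV : StrictConvexOn ℝ Set.univ V)
    (hmin : ∀ (x : Fin n → Euc d) (t : Euc d), ∑ j, V (x j - hatθ x) ≤ ∑ j, V (x j - t))
    (θ : Euc d) (x : Fin n → Euc d) : hatθ (fun j => θ + x j) = θ + hatθ x := by
  refine minimizer_unique hn hV (hmin _) fun t => ?_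
  have h1 : ∀ j, θ + x j - (θ + hatθ x) = x j - hatθ x := fun j => by abel
  have h2 : ∀ j, θ + x j - t = x j - (t - θ) := fun j => by abel
  simpa only [h1, h2] using hmin x (t - θ)

theorem continuous_minimizer (hn : 0 < n) (hV : StrictConvexOn ℝ Set.univ V) (hVc : Continuous V)
    (hmin : ∀ (x : Fin n → Euc d) (t : Euc d), ∑ j, V (x j - hatθ x) ≤ ∑ j, V (x j - t)) :
    Continuous hatθ := by
  rw [continuous_iff_continuousAt]
  intro x₀
  rw [ContinuousAt, Metric.tendsto_nhds]
  intro ε hε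
  set c := hatθ x₀ with hc
  have hev : ∀ᶠ x in nhds x₀, ∀ y ∈ Metric.sphere c ε, ∑ j, V (x j - c) < ∑ j, V (x j - y) := by
    refine (isCompact_sphere c ε).eventually_forall_of_forall_eventually fun y hy => ?_
    have hlt : ∑ j, V (x₀ j - c) < ∑ j, V (x₀ j - y) := by
      refine lt_of_le_of_ne (hmin x₀ y) fun heq => ?_
      have : c = y := minimizer_unique hn hV (hmin x₀) fun t => heq ▸ hmin x₀ t
      rw [← this, Metric.mem_sphere, dist_self] at hy
      exact hε.ne hy
    have hl : Continuous fun p : (Fin n → Euc d) × Euc d => ∑ j, V (p.1 j - c) := by fun_prop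
    have hr : Continuous fun p : (Fin n → Euc d) × Euc d => ∑ j, V (p.1 j - p.2) := by fun_prop
    exact (hl.tendsto (x₀, y)).eventually_lt (hr.tendsto (x₀, y)) hlt
  filter_upwards [hev] with x hx
  by_contra! hfar
  rw [dist_eq_norm] at hfar
  have hpos : 0 < ‖hatθ x - c‖ := hε.trans_le hfar
  set y := AffineMap.lineMap c (hatθ x) (ε / ‖hatθ x - c‖) with hy
  have hys : y ∈ Metric.sphere c ε := by
    rw [mem_sphere_iff_norm, hy, AffineMap.lineMap_apply]
    simp only [vsub_eq_sub, vadd_eq_add, add_sub_cancel_right]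
    rw [norm_smul, Real.norm_of_nonneg (by positivity), div_mul_cancel₀ _ hpos.ne']
  have hseg : y ∈ segment ℝ c (hatθ x) := by
    rw [segment_eq_image_lineMap]
    exact ⟨_, ⟨by positivity, (div_le_one hpos).2 hfar⟩, rfl⟩
  have := (strictConvexOn_sum_translate hn hV x).convexOn.le_max_of_mem_segment
    (Set.mem_univ _) (Set.mem_univ _) hseg
  rw [max_eq_left (hmin x c)] at this
  exact absurd (hx y hys) this.not_gt

end Minimizer

section Score

variable {d n : ℕ} {V : Euc d → ℝ}

theorem norm_fderiv_fderiv (V : Euc d → ℝ) (x : Euc d) :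
    ‖fderiv ℝ (fderiv ℝ V) x‖ = ‖iteratedFDeriv ℝ 2 V x‖ := by
  rw [← norm_iteratedFDeriv_one, norm_iteratedFDeriv_fderiv]

theorem norm_fderiv_fderiv_sub (hV : ContDiff ℝ 2 V) (x y : Euc d) :
    ‖fderiv ℝ (fderiv ℝ V) x - fderiv ℝ (fderiv ℝ V) y‖ =
      ‖iteratedFDeriv ℝ 2 V x - iteratedFDeriv ℝ 2 V y‖ := by
  have hd : Differentiable ℝ V := hV.differentiable (by norm_num)
  have hd2 : Differentiable ℝ (fderiv ℝ V) :=
    (hV.fderiv_right (m := 1) (by norm_num)).differentiable (by norm_num)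
  have h1 := norm_fderiv_fderiv (fun z => V (z + (x - y)) - V z) y
  rw [iteratedFDeriv_diff (l := 2) hV le_rfl, add_sub_cancel] at h1
  rw [← h1]
  have h2 : fderiv ℝ (fun z => V (z + (x - y)) - V z) =
      fun z => fderiv ℝ V (z + (x - y)) - fderiv ℝ V z := by
    funext z
    rw [fderiv_fun_sub ((differentiableAt_comp_add_right _).2 (hd _)) (hd z), fderiv_comp_add_right]
  rw [h2, fderiv_fun_sub ((differentiableAt_comp_add_right _).2 (hd2 _)) (hd2 y),
    fderiv_comp_add_right, add_sub_cancel]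

/-- The empirical mean of `g` over the sample `x`. -/
def sampleMean {F : Type*} [AddCommGroup F] [Module ℝ F] (g : Euc d → F) (x : Fin n → Euc d) : F :=
  (n : ℝ)⁻¹ • ∑ j, g (x j)

theorem norm_sampleMean_le {F : Type*} [NormedAddCommGroup F] [NormedSpace ℝ F] {g : Euc d → F}
    {x : Fin n → Euc d} {K : ℝ} (hn : 0 < n) (hK : ∀ j, ‖g (x j)‖ ≤ K) :
    ‖sampleMean g x‖ ≤ K := by
  have hn' : (0 : ℝ) < n := by exact_mod_cast hn
  rw [sampleMean, norm_smul, norm_inv, Real.norm_natCast, inv_mul_le_iff₀ hn']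
  simpa using norm_sum_le_of_le Finset.univ fun j _ => hK j

theorem norm_fderiv_taylor_le (hV : ContDiff ℝ 2 V) {L : ℝ} (hL : 0 ≤ L)
    (hLip : ∀ x y, ‖iteratedFDeriv ℝ 2 V x - iteratedFDeriv ℝ 2 V y‖ ≤ L * ‖x - y‖)
    (x h : Euc d) :
    ‖fderiv ℝ V (x - h) - fderiv ℝ V x + fderiv ℝ (fderiv ℝ V) x h‖ ≤ L * ‖h‖ ^ 2 := by
  have hd2 : Differentiable ℝ (fderiv ℝ V) :=
    (hV.fderiv_right (m := 1) (by norm_num)).differentiable (by norm_num)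
  have := Convex.norm_image_sub_le_of_norm_fderiv_le' (𝕜 := ℝ) (f := fderiv ℝ V)
    (s := segment ℝ x (x - h)) (φ := fderiv ℝ (fderiv ℝ V) x) (C := L * ‖h‖)
    (fun z _ => hd2 z) (fun z hz => ?_) (convex_segment _ _) (left_mem_segment ℝ _ _)
    (right_mem_segment ℝ _ _)
  · simp only [sub_sub_cancel_left, map_neg, sub_neg_eq_add, norm_neg] at this
    rwa [pow_two, ← mul_assoc]
  · rw [norm_fderiv_fderiv_sub hV]
    refine (hLip z x).trans (mul_le_mul_of_nonneg_left ?_ hL)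
    have := norm_sub_le_of_mem_segment hz
    simpa using this

theorem norm_sampleMean_taylor_le (hn : 0 < n) (hV : ContDiff ℝ 2 V) {L : ℝ} (hL : 0 ≤ L)
    (hLip : ∀ x y, ‖iteratedFDeriv ℝ 2 V x - iteratedFDeriv ℝ 2 V y‖ ≤ L * ‖x - y‖)
    (x : Fin n → Euc d) (h : Euc d) :
    ‖sampleMean (fun z => fderiv ℝ V (z - h)) x - sampleMean (fderiv ℝ V) x +
      sampleMean (fderiv ℝ (fderiv ℝ V)) x h‖ ≤ L * ‖h‖ ^ 2 := by
  have := norm_sampleMean_le (x := x) (g := fun z =>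
    fderiv ℝ V (z - h) - fderiv ℝ V z + fderiv ℝ (fderiv ℝ V) z h) hn
    fun j => norm_fderiv_taylor_le hV hL hLip (x j) h
  have heq : sampleMean (fun z => fderiv ℝ V (z - h) - fderiv ℝ V z +
      fderiv ℝ (fderiv ℝ V) z h) x = sampleMean (fun z => fderiv ℝ V (z - h)) x -
        sampleMean (fderiv ℝ V) x + sampleMean (fderiv ℝ (fderiv ℝ V)) x h := by
    simp only [sampleMean, Finset.sum_add_distrib, Finset.sum_sub_distrib, smul_add, smul_sub,
      smul_apply, sum_apply]
  rwa [← heq]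

theorem hasFDerivAt_sum_translate (hV : ContDiff ℝ 2 V) (x : Fin n → Euc d) (t : Euc d) :
    HasFDerivAt (fun s => ∑ j, V (x j - s)) (-∑ j, fderiv ℝ V (x j - t)) t := by
  have hd : Differentiable ℝ V := hV.differentiable (by norm_num)
  rw [← Finset.sum_neg_distrib]
  refine HasFDerivAt.fun_sum fun j _ => ?_
  have h := (hd (x j - t)).hasFDerivAt.comp t ((hasFDerivAt_id t).const_sub (x j))
  have heq : -fderiv ℝ V (x j - t) =
      (fderiv ℝ V (x j - t)).comp (-ContinuousLinearMap.id ℝ (Euc d)) := by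
    ext v
    simp
  rw [heq]
  exact h

theorem sampleMean_fderiv_minimizer (hV : ContDiff ℝ 2 V) {x : Fin n → Euc d} {T : Euc d}
    (hmin : ∀ t, ∑ j, V (x j - T) ≤ ∑ j, V (x j - t)) :
    sampleMean (fun z => fderiv ℝ V (z - T)) x = 0 := by
  have h0 : IsLocalMin (fun s => ∑ j, V (x j - s)) T := Filter.Eventually.of_forall hmin
  have := h0.hasFDerivAt_eq_zero (hasFDerivAt_sum_translate hV x T)
  rw [neg_eq_zero] at this
  rw [sampleMean, this, smul_zero]

theorem sampleMean_fderiv_nonneg (hn : 0 < n) (hVc : StrictConvexOn ℝ Set.univ V)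
    (hV : ContDiff ℝ 2 V) {x : Fin n → Euc d} {T : Euc d}
    (hmin : ∀ t, ∑ j, V (x j - T) ≤ ∑ j, V (x j - t)) {t : ℝ} (ht : t ≤ 1) :
    0 ≤ sampleMean (fun z => fderiv ℝ V (z - t • T)) x T := by
  rcases ht.lt_or_eq with ht | rfl
  · have hconv : ConvexOn ℝ Set.univ (fun s : ℝ => ∑ j, V (x j - s • T)) :=
      (strictConvexOn_sum_translate hn hVc x).convexOn.comp_linearMap
        (LinearMap.toSpanSingleton ℝ (Euc d) T)
    have hder : HasDerivAt (fun s : ℝ => ∑ j, V (x j - s • T))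
        ((-∑ j, fderiv ℝ V (x j - t • T)) T) t := by
      have h1 : HasDerivAt (fun s : ℝ => s • T) T t := by
        simpa using (hasDerivAt_id' t).smul_const T
      exact (hasFDerivAt_sum_translate hV x (t • T)).comp_hasDerivAt t h1
    have h2 := hconv.le_slope_of_hasDerivAt (Set.mem_univ t) (Set.mem_univ 1) ht hder
    have h3 : slope (fun s : ℝ => ∑ j, V (x j - s • T)) t 1 ≤ 0 := by
      rw [slope_def_field]
      refine div_nonpos_of_nonpos_of_nonneg ?_ (by linarith)
      simpa using hmin (t • T)
    have h4 := h2.trans h3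
    simp only [neg_apply] at h4
    simp only [sampleMean, smul_apply, smul_eq_mul]
    exact mul_nonneg (by positivity) (by linarith)
  · simp [sampleMean_fderiv_minimizer hV hmin]

theorem norm_minimizer_le (hn : 0 < n) (hVc : StrictConvexOn ℝ Set.univ V)
    (hV : ContDiff ℝ 2 V) {L m : ℝ} (hL : 0 < L) (hm : 0 < m)
    (hLip : ∀ x y, ‖iteratedFDeriv ℝ 2 V x - iteratedFDeriv ℝ 2 V y‖ ≤ L * ‖x - y‖)
    {x : Fin n → Euc d} {T : Euc d}
    (hmin : ∀ t, ∑ j, V (x j - T) ≤ ∑ j, V (x j - t))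
    (hH : m / 2 * ‖T‖ ^ 2 ≤ sampleMean (fderiv ℝ (fderiv ℝ V)) x T T)
    (hS : ‖sampleMean (fderiv ℝ V) x‖ < m ^ 2 / (16 * L)) :
    ‖T‖ ≤ 4 / m * ‖sampleMean (fderiv ℝ V) x‖ := by
  rcases eq_or_ne T 0 with rfl | hT
  · rw [norm_zero]; positivity
  have hTpos : 0 < ‖T‖ := norm_pos_iff.2 hT
  have key : ∀ t : ℝ, 0 ≤ t → t ≤ 1 → t * ‖T‖ ≤ m / (4 * L) →
      t * ‖T‖ * (m / 4) ≤ ‖sampleMean (fderiv ℝ V) x‖ := by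
    intro t ht0 ht1 htr
    have h1 := sampleMean_fderiv_nonneg hn hVc hV hmin ht1
    have h2 := norm_sampleMean_taylor_le hn hV hL.le hLip x (t • T)
    have h3 := (le_abs_self _).trans ((ContinuousLinearMap.le_opNorm _ T).trans
      (mul_le_mul_of_nonneg_right h2 (norm_nonneg T)))
    have h4 := (le_abs_self _).trans (ContinuousLinearMap.le_opNorm
      (sampleMean (fderiv ℝ V) x) T)
    simp only [add_apply, sub_apply, map_smul,
      smul_apply, smul_eq_mul, norm_smul, Real.norm_of_nonneg ht0] at h3
    have h5 : t * (m / 2 * ‖T‖ ^ 2) ≤ ‖sampleMean (fderiv ℝ V) x‖ * ‖T‖ +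
        L * (t * ‖T‖) ^ 2 * ‖T‖ := by
      nlinarith [mul_le_mul_of_nonneg_left hH ht0]
    have h6 : L * (t * ‖T‖) ^ 2 ≤ m / 4 * (t * ‖T‖) := by
      have h7 : L * (t * ‖T‖) ≤ m / 4 := by
        calc L * (t * ‖T‖) ≤ L * (m / (4 * L)) := by gcongr
          _ = m / 4 := by field_simp
      nlinarith [mul_nonneg ht0 hTpos.le]
    refine le_of_mul_le_mul_right ?_ hTpos
    nlinarith [mul_le_mul_of_nonneg_right h6 hTpos.le]
  rcases le_total ‖T‖ (m / (4 * L)) with h | h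
  · have := key 1 zero_le_one le_rfl (by simpa using h)
    rw [div_mul_eq_mul_div, le_div_iff₀ hm]
    linarith
  · have hr : m / (4 * L) / ‖T‖ * ‖T‖ = m / (4 * L) := div_mul_cancel₀ _ hTpos.ne'
    have := key (m / (4 * L) / ‖T‖) (by positivity) ((div_le_one hTpos).2 h) hr.le
    rw [hr] at this
    have h8 : m / (4 * L) * (m / 4) = m ^ 2 / (16 * L) := by field_simp; ring
    linarith

end Score

section Variance

variable {d n : ℕ} {μ : Measure (Euc d)} [IsProbabilityMeasure μ]

theorem sampleMean_apply {F G : Type*} [NormedAddCommGroup F] [NormedSpace ℝ F]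
    [NormedAddCommGroup G] [NormedSpace ℝ G] (X : Euc d → F →L[ℝ] G) (x : Fin n → Euc d) (u : F) :
    sampleMean X x u = sampleMean (fun z => X z u) x := by
  simp [sampleMean]

theorem continuous_sampleMean {F : Type*} [NormedAddCommGroup F] [NormedSpace ℝ F]
    {g : Euc d → F} (hg : Continuous g) :
    Continuous (fun x : Fin n → Euc d => sampleMean g x) := by
  unfold sampleMean
  fun_prop

theorem memLp_sampleMean {F : Type*} [NormedAddCommGroup F] [NormedSpace ℝ F]
    {g : Euc d → F} (hg : MemLp g 2 μ) :
    MemLp (fun x : Fin n → Euc d => sampleMean g x) 2 (Measure.pi fun _ => μ) :=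
  (memLp_finsetSum Finset.univ fun j _ =>
    hg.comp_measurePreserving (measurePreserving_eval (fun _ => μ) j)).const_smul _

theorem integral_sampleMean {F : Type*} [NormedAddCommGroup F] [NormedSpace ℝ F]
    (hn : 0 < n) {g : Euc d → F} (hg : Integrable g μ) :
    ∫ x : Fin n → Euc d, sampleMean g x ∂(Measure.pi fun _ => μ) = ∫ z, g z ∂μ := by
  have hn' : (n : ℝ) ≠ 0 := by exact_mod_cast hn.ne'
  have hi : ∀ j : Fin n, Integrable (fun x : Fin n → Euc d => g (x j)) (Measure.pi fun _ => μ) :=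
    fun j => (measurePreserving_eval (fun _ => μ) j).integrable_comp_of_integrable hg
  have he : ∀ j : Fin n, ∫ x : Fin n → Euc d, g (x j) ∂(Measure.pi fun _ => μ) = ∫ z, g z ∂μ :=
    fun j => integral_comp_eval (μ := fun _ : Fin n => μ) hg.aestronglyMeasurable
  simp only [sampleMean]
  rw [integral_smul, integral_finsetSum _ fun j _ => hi j]
  simp only [he, Finset.sum_const, Finset.card_univ, Fintype.card_fin]
  rw [← Nat.cast_smul_eq_nsmul ℝ, inv_smul_smul₀ hn']

theorem integral_sampleMean_sub_sq_le (hn : 0 < n) {X : Euc d → ℝ} (hX : MemLp X 2 μ) :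
    ∫ x : Fin n → Euc d, (sampleMean X x - ∫ z, X z ∂μ) ^ 2 ∂(Measure.pi fun _ => μ) ≤
      (n : ℝ)⁻¹ * ∫ z, X z ^ 2 ∂μ := by
  have hn' : (n : ℝ) ≠ 0 := by exact_mod_cast hn.ne'
  have h1 := ProbabilityTheory.variance_sum_pi (ι := Fin n) (μ := fun _ => μ) (X := fun _ => X)
    fun _ => hX
  have h2 := integral_sampleMean hn (hX.integrable one_le_two)
  have h3 : (fun x : Fin n → Euc d => sampleMean X x) =
      fun x => (n : ℝ)⁻¹ * (∑ i, fun ω : Fin n → Euc d => X (ω i)) x := by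
    funext x
    simp [sampleMean]
  have h4 := ProbabilityTheory.variance_eq_integral
    (memLp_sampleMean (n := n) hX).aestronglyMeasurable.aemeasurable
  rw [h2] at h4
  rw [← h4, h3, ProbabilityTheory.variance_const_mul, h1]
  simp only [Finset.sum_const, Finset.card_univ, Fintype.card_fin, nsmul_eq_mul]
  have h5 := ProbabilityTheory.variance_le_expectation_sq (X := X) hX.aestronglyMeasurable
  calc (n : ℝ)⁻¹ ^ 2 * (n * ProbabilityTheory.variance X μ)
      = (n : ℝ)⁻¹ * ProbabilityTheory.variance X μ := by field_simp
    _ ≤ _ := by gcongr; exact h5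

theorem sum_apply_basisFun_sq (φ : Euc d →L[ℝ] ℝ) :
    ∑ i, φ (EuclideanSpace.basisFun (Fin d) ℝ i) ^ 2 = ‖φ‖ ^ 2 := by
  rw [← (InnerProductSpace.toDual ℝ (Euc d)).symm.norm_map φ,
    ← (EuclideanSpace.basisFun (Fin d) ℝ).sum_sq_inner_left]
  simp only [InnerProductSpace.toDual_symm_apply]

theorem norm_sq_le_sum_basisFun {F : Type*} [NormedAddCommGroup F] [NormedSpace ℝ F]
    (φ : Euc d →L[ℝ] F) :
    ‖φ‖ ^ 2 ≤ ∑ i, ‖φ (EuclideanSpace.basisFun (Fin d) ℝ i)‖ ^ 2 := by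
  set b := EuclideanSpace.basisFun (Fin d) ℝ
  refine (Real.le_sqrt (norm_nonneg _) (by positivity)).1 ?_
  refine φ.opNorm_le_bound (by positivity) fun v => ?_
  calc ‖φ v‖ = ‖φ (∑ i, ⟪b i, v⟫ • b i)‖ := by rw [b.sum_repr' v]
    _ ≤ ∑ i, ‖φ (b i)‖ * ‖⟪b i, v⟫‖ := by
        rw [map_sum]
        refine norm_sum_le_of_le _ fun i _ => ?_
        rw [map_smul, norm_smul, mul_comm]
    _ ≤ √(∑ i, ‖φ (b i)‖ ^ 2) * √(∑ i, ‖⟪b i, v⟫‖ ^ 2) := Real.sum_mul_le_sqrt_mul_sqrt _ _ _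
    _ = _ := by rw [b.sum_sq_norm_inner_right, Real.sqrt_sq (norm_nonneg _)]

theorem integral_norm_sampleMean_sub_sq_le (hn : 0 < n) {X : Euc d → Euc d →L[ℝ] ℝ}
    (hX : MemLp X 2 μ) :
    ∫ x : Fin n → Euc d, ‖sampleMean X x - ∫ z, X z ∂μ‖ ^ 2 ∂(Measure.pi fun _ => μ) ≤
      (n : ℝ)⁻¹ * ∫ z, ‖X z‖ ^ 2 ∂μ := by
  have hXi : Integrable X μ := hX.integrable one_le_two
  have hu : ∀ u, MemLp (fun z => X z u) 2 μ := fun u =>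
    (ContinuousLinearMap.apply ℝ ℝ u).comp_memLp' hX
  have hc : ∀ u, (∫ z, X z ∂μ) u = ∫ z, X z u ∂μ := fun u =>
    ContinuousLinearMap.integral_apply hXi u
  simp only [← sum_apply_basisFun_sq, sub_apply, hc, sampleMean_apply]
  have hi : ∀ i : Fin d, Integrable (fun x : Fin n → Euc d =>
      (sampleMean (fun z => X z (EuclideanSpace.basisFun (Fin d) ℝ i)) x -
        ∫ z, X z (EuclideanSpace.basisFun (Fin d) ℝ i) ∂μ) ^ 2) (Measure.pi fun _ => μ) :=
    fun i => ((memLp_sampleMean (hu _)).sub (memLp_const _)).integrable_sq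
  rw [integral_finsetSum _ fun i _ => hi i,
    integral_finsetSum _ fun i _ => (hu _).integrable_sq, Finset.mul_sum]
  exact Finset.sum_le_sum fun i _ => integral_sampleMean_sub_sq_le hn (hu _)

end Variance

section FisherInformation

variable {d : ℕ} {V : Euc d → ℝ}

theorem isProbabilityMeasure_noiseMeasure (h1 : ∫ x, Real.exp (-(V x)) = 1) :
    IsProbabilityMeasure (noiseMeasure V) := by
  have hi : Integrable fun x => Real.exp (-(V x)) := by
    by_contra h
    rw [integral_undef h] at h1
    exact zero_ne_one h1
  refine ⟨?_⟩
  rw [noiseMeasure, withDensity_apply _ MeasurableSet.univ, Measure.restrict_univ,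
    ← ofReal_integral_eq_lintegral_ofReal hi (ae_of_all _ fun x => (Real.exp_pos _).le), h1,
    ENNReal.ofReal_one]

theorem integrable_noiseMeasure_iff (hV : Continuous V) {g : Euc d → ℝ} :
    Integrable g (noiseMeasure V) ↔ Integrable fun x => g x * Real.exp (-(V x)) := by
  rw [noiseMeasure, integrable_withDensity_iff (by fun_prop) (ae_of_all _ fun x => by simp)]
  simp only [ENNReal.toReal_ofReal (Real.exp_pos _).le]

theorem integral_noiseMeasure (hV : Continuous V) (g : Euc d → ℝ) :
    ∫ x, g x ∂noiseMeasure V = ∫ x, g x * Real.exp (-(V x)) := by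
  rw [noiseMeasure, integral_withDensity_eq_integral_toReal_smul (by fun_prop)
    (ae_of_all _ fun x => by simp)]
  simp only [ENNReal.toReal_ofReal (Real.exp_pos _).le, smul_eq_mul, mul_comm]

theorem fderiv_exp_neg (hV : Differentiable ℝ V) (x w : Euc d) :
    fderiv ℝ (fun x => Real.exp (-(V x))) x w = -(fderiv ℝ V x w * Real.exp (-(V x))) := by
  have h : HasFDerivAt (fun x => Real.exp (-(V x))) _ x := (hV x).hasFDerivAt.neg.exp
  rw [h.fderiv]
  simp [mul_comm]

theorem integral_fderiv_mul_noiseMeasure (hV : ContDiff ℝ 2 V) {g : Euc d → ℝ}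
    (hg : Differentiable ℝ g) {w : Euc d} (hgi : Integrable g (noiseMeasure V))
    (hgw : Integrable (fun x => fderiv ℝ g x w) (noiseMeasure V))
    (hgV : Integrable (fun x => g x * fderiv ℝ V x w) (noiseMeasure V)) :
    ∫ x, g x * fderiv ℝ V x w ∂noiseMeasure V = ∫ x, fderiv ℝ g x w ∂noiseMeasure V := by
  have hVd : Differentiable ℝ V := hV.differentiable (by norm_num)
  have hc := hV.continuous
  rw [integrable_noiseMeasure_iff hc] at hgi hgw hgV
  have h := integral_mul_fderiv_eq_neg_fderiv_mul_of_integrable (𝕜 := ℝ) (μ := volume) (f := g)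
    (g := fun x => Real.exp (-(V x))) (v := w) hgw
    (by
      simp only [fderiv_exp_neg hVd, mul_neg, ← mul_assoc]
      exact hgV.neg) hgi (fun x _ => hg x) (fun x _ => (hVd x).neg.exp)
  simp only [fderiv_exp_neg hVd, mul_neg, ← mul_assoc, integral_neg, neg_inj] at h
  rw [integral_noiseMeasure hc, integral_noiseMeasure hc, h]

variable {J : Euc d →L[ℝ] Euc d} {m M : ℝ}

theorem integrable_fderiv_mul_fderiv
    (hJ : ∀ u, J u = ∫ x, ⟪gradient V x, u⟫ • gradient V x ∂noiseMeasure V) (hm : 0 < m)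
    (hJm : ∀ u : Euc d, m * ‖u‖ ^ 2 ≤ ⟪J u, u⟫) (u w : Euc d) :
    Integrable (fun x => fderiv ℝ V x u * fderiv ℝ V x w) (noiseMeasure V) ∧
      ⟪J u, w⟫ = ∫ x, fderiv ℝ V x u * fderiv ℝ V x w ∂noiseMeasure V := by
  rcases eq_or_ne u 0 with rfl | hu
  · simp
  have hi : Integrable (fun x => ⟪gradient V x, u⟫ • gradient V x) (noiseMeasure V) := by
    by_contra h
    have h1 := hJm u
    rw [hJ u, integral_undef h, inner_zero_left] at h1
    have : 0 < ‖u‖ := norm_pos_iff.2 hu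
    nlinarith [mul_pos hm (pow_pos this 2)]
  have h2 : ∀ x, fderiv ℝ V x u * fderiv ℝ V x w =
      ⟪w, ⟪gradient V x, u⟫ • gradient V x⟫ := fun x => by
    rw [real_inner_smul_right, inner_gradient_left, real_inner_comm, inner_gradient_left]
  simp only [h2]
  refine ⟨hi.const_inner w, ?_⟩
  rw [integral_inner hi, ← hJ, real_inner_comm]

theorem memLp_fderiv (hV : ContDiff ℝ 2 V)
    (hJ : ∀ u, J u = ∫ x, ⟪gradient V x, u⟫ • gradient V x ∂noiseMeasure V) (hm : 0 < m)
    (hJm : ∀ u : Euc d, m * ‖u‖ ^ 2 ≤ ⟪J u, u⟫) : MemLp (fderiv ℝ V) 2 (noiseMeasure V) := by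
  have hc : Continuous (fderiv ℝ V) := hV.continuous_fderiv (by norm_num)
  rw [memLp_two_iff_integrable_sq_norm hc.aestronglyMeasurable]
  simp only [← sum_apply_basisFun_sq]
  simp only [pow_two]
  exact integrable_finsetSum _ fun i _ => (integrable_fderiv_mul_fderiv hJ hm hJm _ _).1

variable [IsProbabilityMeasure (noiseMeasure V)]

theorem memLp_fderiv_fderiv_apply (hV : ContDiff ℝ 2 V)
    (hM : ∀ x, ‖iteratedFDeriv ℝ 2 V x‖ ≤ M) (w : Euc d) :
    MemLp (fun x => fderiv ℝ (fderiv ℝ V) x w) 2 (noiseMeasure V) := by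
  have hc : Continuous (fderiv ℝ (fderiv ℝ V)) :=
    (hV.fderiv_right (m := 1) (by norm_num)).continuous_fderiv (by norm_num)
  exact MemLp.of_bound (hc.clm_apply continuous_const).aestronglyMeasurable (M * ‖w‖)
    (ae_of_all _ fun x => ContinuousLinearMap.le_of_opNorm_le _
      ((norm_fderiv_fderiv V x).trans_le (hM x)) w)

theorem integral_fderiv_eq_zero (hV : ContDiff ℝ 2 V)
    (hL2 : MemLp (fderiv ℝ V) 2 (noiseMeasure V)) : ∫ x, fderiv ℝ V x ∂noiseMeasure V = 0 := by
  have hi : Integrable (fderiv ℝ V) (noiseMeasure V) := hL2.integrable one_le_two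
  ext w
  rw [ContinuousLinearMap.integral_apply hi]
  have := integral_fderiv_mul_noiseMeasure hV (g := fun _ => 1) (w := w)
    (differentiable_const _) (integrable_const _) (by simp) (by simpa using hi.apply_continuousLinearMap w)
  simpa using this

theorem integral_fderiv_fderiv_apply (hV : ContDiff ℝ 2 V)
    (hM : ∀ x, ‖iteratedFDeriv ℝ 2 V x‖ ≤ M)
    (hJ : ∀ u, J u = ∫ x, ⟪gradient V x, u⟫ • gradient V x ∂noiseMeasure V) (hm : 0 < m)
    (hJm : ∀ u : Euc d, m * ‖u‖ ^ 2 ≤ ⟪J u, u⟫) (u w : Euc d) :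
    (∫ x, fderiv ℝ (fderiv ℝ V) x w ∂noiseMeasure V) u = ⟪J u, w⟫ := by
  have hi1 : Integrable (fderiv ℝ V) (noiseMeasure V) :=
    (memLp_fderiv hV hJ hm hJm).integrable one_le_two
  have hd2 : Differentiable ℝ (fderiv ℝ V) :=
    (hV.fderiv_right (m := 1) (by norm_num)).differentiable (by norm_num)
  have hiw := (memLp_fderiv_fderiv_apply hV hM w).integrable one_le_two
  rw [ContinuousLinearMap.integral_apply hiw, (integrable_fderiv_mul_fderiv hJ hm hJm u w).2]
  have hf : ∀ x, fderiv ℝ (fun y => fderiv ℝ V y u) x w = fderiv ℝ (fderiv ℝ V) x w u := by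
    intro x
    rw [fderiv_clm_apply (hd2 x) (differentiableAt_const u)]
    simp
  have := integral_fderiv_mul_noiseMeasure hV (g := fun x => fderiv ℝ V x u) (w := w)
    (hd2.clm_apply (differentiable_const u)) (hi1.apply_continuousLinearMap u)
    (by simpa only [hf] using hiw.apply_continuousLinearMap u)
    (integrable_fderiv_mul_fderiv hJ hm hJm u w).1
  rw [this]
  simp only [hf]

theorem integral_norm_fderiv_sq_le (hV : ContDiff ℝ 2 V)
    (hM : ∀ x, ‖iteratedFDeriv ℝ 2 V x‖ ≤ M)
    (hJ : ∀ u, J u = ∫ x, ⟪gradient V x, u⟫ • gradient V x ∂noiseMeasure V) (hm : 0 < m)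
    (hJm : ∀ u : Euc d, m * ‖u‖ ^ 2 ≤ ⟪J u, u⟫) :
    ∫ x, ‖fderiv ℝ V x‖ ^ 2 ∂noiseMeasure V ≤ d * M := by
  simp only [← sum_apply_basisFun_sq]
  simp only [pow_two]
  rw [integral_finsetSum _ fun i _ => (integrable_fderiv_mul_fderiv hJ hm hJm _ _).1]
  calc _ ≤ ∑ _i : Fin d, M := by
        refine Finset.sum_le_sum fun i _ => ?_
        rw [← (integrable_fderiv_mul_fderiv hJ hm hJm _ _).2,
          ← integral_fderiv_fderiv_apply hV hM hJ hm hJm]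
        set e := EuclideanSpace.basisFun (Fin d) ℝ i with he
        have he1 : ‖e‖ = 1 := (EuclideanSpace.basisFun (Fin d) ℝ).norm_eq_one i
        have hn := norm_integral_le_of_norm_le_const (μ := noiseMeasure V)
          (ae_of_all _ fun x => ContinuousLinearMap.le_of_opNorm_le _
            ((norm_fderiv_fderiv V x).trans_le (hM x)) e)
        have := ContinuousLinearMap.le_of_opNorm_le _ hn e
        simp only [he1, probReal_univ, mul_one] at this
        exact (le_abs_self _).trans this
    _ = d * M := by simp

end FisherInformation

section GoodEvent

variable {d : ℕ} {Ω : Type*} [MeasurableSpace Ω] {P : Measure Ω}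
  {T : Ω → Euc d} {S : Ω → Euc d →L[ℝ] ℝ} {W : Ω → ℝ} {a b c p q δ : ℝ}

theorem setIntegral_norm_sq_le {good : Set Ω} (hg : MeasurableSet good) (hS : MemLp S 2 P)
    (hT : ∀ ω ∈ good, ‖T ω‖ ≤ a * ‖S ω‖)
    (hSi : ∫ ω, ‖S ω‖ ^ 2 ∂P ≤ q * δ) :
    ∫ ω in good, ‖T ω‖ ^ 2 ∂P ≤ a ^ 2 * q * δ := by
  have hS2 : Integrable (fun ω => a ^ 2 * ‖S ω‖ ^ 2) P :=
    (hS.integrable_norm_pow two_ne_zero).const_mul _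
  calc ∫ ω in good, ‖T ω‖ ^ 2 ∂P ≤ ∫ ω in good, a ^ 2 * ‖S ω‖ ^ 2 ∂P := by
        refine integral_mono_of_nonneg (ae_of_all _ fun ω => by positivity) hS2.integrableOn ?_
        filter_upwards [ae_restrict_mem hg] with ω hω
        rw [← mul_pow]
        exact pow_le_pow_left₀ (norm_nonneg _) (hT ω hω) 2
    _ ≤ ∫ ω, a ^ 2 * ‖S ω‖ ^ 2 ∂P :=
        setIntegral_le_integral hS2 (ae_of_all _ fun ω => by positivity)
    _ = a ^ 2 * ∫ ω, ‖S ω‖ ^ 2 ∂P := integral_const_mul _ _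
    _ ≤ a ^ 2 * (q * δ) := by gcongr
    _ = _ := by ring

variable [IsProbabilityMeasure P]

theorem measureReal_compl_le {good : Set Ω} (hg : MeasurableSet good)
    (hW : Integrable W P) (hS : MemLp S 2 P) (hW0 : ∀ ω, 0 ≤ W ω) (hb : 0 < b) (hc : 0 < c)
    (hgood : ∀ ω, W ω ≤ b → ‖S ω‖ < c → ω ∈ good)
    (hWi : ∫ ω, W ω ∂P ≤ p * δ) (hSi : ∫ ω, ‖S ω‖ ^ 2 ∂P ≤ q * δ) :
    P.real goodᶜ ≤ (p / b + q / c ^ 2) * δ := by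
  have hS2 : Integrable (fun ω => ‖S ω‖ ^ 2) P := hS.integrable_norm_pow two_ne_zero
  have hle : ∀ ω, goodᶜ.indicator (fun _ => (1 : ℝ)) ω ≤ W ω / b + ‖S ω‖ ^ 2 / c ^ 2 := by
    intro ω
    have h1 : 0 ≤ W ω / b := div_nonneg (hW0 ω) hb.le
    have h2 : 0 ≤ ‖S ω‖ ^ 2 / c ^ 2 := by positivity
    refine Set.indicator_apply_le' (fun hω => ?_) fun _ => by positivity
    by_cases hWω : W ω ≤ b
    · have hSω : c ≤ ‖S ω‖ := not_lt.1 fun h => hω (hgood ω hWω h)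
      have : 1 ≤ ‖S ω‖ ^ 2 / c ^ 2 := by
        rw [one_le_div (by positivity)]
        gcongr
      linarith
    · have : 1 ≤ W ω / b := by
        rw [one_le_div hb]
        linarith
      linarith
  have h := integral_mono ((integrable_const (1 : ℝ)).indicator hg.compl)
    ((hW.div_const b).add (hS2.div_const (c ^ 2))) hle
  rw [integral_indicator_const _ hg.compl, smul_eq_mul, mul_one] at h
  refine h.trans ?_
  simp only [Pi.add_apply]
  rw [integral_add (hW.div_const b) (hS2.div_const (c ^ 2)), integral_div, integral_div, add_mul,
    div_mul_eq_mul_div, div_mul_eq_mul_div]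
  gcongr

theorem norm_setIntegral_le_of_integral_eq_zero {good : Set Ω} (hg : MeasurableSet good)
    (hS : MemLp S 2 P) (hS0 : ∫ ω, S ω ∂P = 0) (hSi : ∫ ω, ‖S ω‖ ^ 2 ∂P ≤ q * δ)
    (hbad : P.real goodᶜ ≤ p * δ) : ‖∫ ω in good, S ω ∂P‖ ≤ (p + q) / 2 * δ := by
  have hS1 : Integrable S P := hS.integrable one_le_two
  have hS2 : Integrable (fun ω => ‖S ω‖ ^ 2) P := hS.integrable_norm_pow two_ne_zero
  have h1 : ∫ ω in good, S ω ∂P = -∫ ω in goodᶜ, S ω ∂P := by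
    rw [eq_neg_iff_add_eq_zero, integral_add_compl hg hS1, hS0]
  have hi : Integrable (fun ω => (‖S ω‖ ^ 2 + 1) / 2) P :=
    (hS2.add (integrable_const 1)).div_const 2
  rw [h1, norm_neg]
  calc ‖∫ ω in goodᶜ, S ω ∂P‖ ≤ ∫ ω in goodᶜ, (‖S ω‖ ^ 2 + 1) / 2 ∂P :=
        norm_integral_le_of_norm_le hi.integrableOn
          (ae_of_all _ fun ω => by nlinarith [sq_nonneg (‖S ω‖ - 1)])
    _ = ((∫ ω in goodᶜ, ‖S ω‖ ^ 2 ∂P) + P.real goodᶜ) / 2 := by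
        rw [integral_div, integral_add hS2.integrableOn (integrable_const 1).integrableOn]
        simp
    _ ≤ (q * δ + p * δ) / 2 := by
        gcongr
        exact (setIntegral_le_integral hS2 (ae_of_all _ fun ω => by positivity)).trans hSi
    _ = _ := by ring

theorem norm_setIntegral_minimizer_le {good : Set Ω} (hg : MeasurableSet good)
    {H : Euc d →L[ℝ] Euc d →L[ℝ] ℝ} {R m p₁ p₂ p₃ p₄ : ℝ} (hm : 0 < m) (ha : 0 ≤ a)
    (hH : ∀ u, m * ‖u‖ ^ 2 ≤ H u u) (hTm : Measurable T) (hR : ∀ ω ∈ good, ‖T ω‖ ≤ R)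
    (hS : MemLp S 2 P) (hS0 : ∫ ω, S ω ∂P = 0) (hW : Integrable W P) (hW0 : ∀ ω, 0 ≤ W ω)
    (hlin : ∀ ω ∈ good, ‖H (T ω) - S ω‖ ≤ W ω + a * ‖T ω‖ ^ 2)
    (hWi : ∫ ω, W ω ∂P ≤ p₁ * δ) (hSi : ∫ ω, ‖S ω‖ ^ 2 ∂P ≤ p₂ * δ)
    (hbad : P.real goodᶜ ≤ p₃ * δ) (h2 : ∫ ω in good, ‖T ω‖ ^ 2 ∂P ≤ p₄ * δ) :
    ‖∫ ω in good, T ω ∂P‖ ≤ ((p₃ + p₂) / 2 + p₁ + a * p₄) / m * δ := by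
  have hTi : Integrable T (P.restrict good) := by
    have := integrableOn_norm_pow_of_bound (P := P) hTm hg hR 1
    simp only [pow_one] at this
    exact (integrable_norm_iff hTm.aestronglyMeasurable).1 this
  have hT2 := integrableOn_norm_pow_of_bound (P := P) hTm hg hR 2
  have hS1 : Integrable S (P.restrict good) := (hS.integrable one_le_two).integrableOn
  have hHT : Integrable (fun ω => H (T ω)) (P.restrict good) := H.integrable_comp hTi
  set v := ∫ ω in good, T ω ∂P with hv
  have hHv : H v = (∫ ω in good, S ω ∂P) + ∫ ω in good, (H (T ω) - S ω) ∂P := by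
    rw [integral_sub hHT hS1, add_sub_cancel, hv, H.integral_comp_comm hTi]
  have h3 : ‖∫ ω in good, (H (T ω) - S ω) ∂P‖ ≤ p₁ * δ + a * (p₄ * δ) := by
    calc _ ≤ ∫ ω in good, (W ω + a * ‖T ω‖ ^ 2) ∂P := by
          refine norm_integral_le_of_norm_le (hW.integrableOn.add (hT2.const_mul a)) ?_
          filter_upwards [ae_restrict_mem hg] with ω hω using hlin ω hω
      _ = (∫ ω in good, W ω ∂P) + a * ∫ ω in good, ‖T ω‖ ^ 2 ∂P := by
          rw [integral_add hW.integrableOn (hT2.const_mul a), integral_const_mul]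
      _ ≤ _ := by
          gcongr
          exact (setIntegral_le_integral hW (ae_of_all _ hW0)).trans hWi
  have h4 := norm_setIntegral_le_of_integral_eq_zero hg hS hS0 hSi hbad
  have h5 : m * ‖v‖ ≤ ‖H v‖ := by
    rcases eq_or_ne v 0 with h0 | h0
    · simp [h0]
    refine le_of_mul_le_mul_right ?_ (norm_pos_iff.2 h0)
    calc m * ‖v‖ * ‖v‖ = m * ‖v‖ ^ 2 := by ring
      _ ≤ H v v := hH v
      _ ≤ ‖H v‖ * ‖v‖ := (le_abs_self _).trans ((H v).le_opNorm v)
  have h6 := norm_add_le_of_le h4 h3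
  rw [← hHv] at h6
  rw [div_mul_eq_mul_div, le_div_iff₀ hm]
  linarith

end GoodEvent

section Linearization

variable {d n : ℕ} {V : Euc d → ℝ} {H : Euc d →L[ℝ] Euc d →L[ℝ] ℝ} {L : ℝ}
  {x : Fin n → Euc d} {T : Euc d}

theorem norm_apply_minimizer_sub_le (hn : 0 < n) (hV : ContDiff ℝ 2 V) (hL : 0 ≤ L)
    (hLip : ∀ x y, ‖iteratedFDeriv ℝ 2 V x - iteratedFDeriv ℝ 2 V y‖ ≤ L * ‖x - y‖)
    (hmin : ∀ t, ∑ j, V (x j - T) ≤ ∑ j, V (x j - t)) {w : ℝ}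
    (hw : ‖sampleMean (fderiv ℝ (fderiv ℝ V)) x - H‖ ^ 2 ≤ w) :
    ‖H T - sampleMean (fderiv ℝ V) x‖ ≤ w + (1 + L) * ‖T‖ ^ 2 := by
  have h1 := norm_sampleMean_taylor_le hn hV hL hLip x T
  rw [sampleMean_fderiv_minimizer hV hmin] at h1
  set D := sampleMean (fderiv ℝ (fderiv ℝ V)) x
  set S := sampleMean (fderiv ℝ V) x
  have h2 : H T - S = (0 - S + D T) - (D - H) T := by
    rw [sub_apply]
    abel
  have h3 := (D - H).le_opNorm T
  rw [h2]
  refine (norm_sub_le_of_le h1 h3).trans ?_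
  nlinarith [sq_nonneg (‖D - H‖ - ‖T‖), norm_nonneg T, sq_nonneg ‖T‖, sq_nonneg ‖D - H‖]

theorem half_mul_sq_le_apply {m : ℝ} (hm : 0 < m) (hH : ∀ u, m * ‖u‖ ^ 2 ≤ H u u)
    {D : Euc d →L[ℝ] Euc d →L[ℝ] ℝ} (hD : ‖D - H‖ ^ 2 ≤ m ^ 2 / 4) :
    m / 2 * ‖T‖ ^ 2 ≤ D T T := by
  have h1 : ‖D - H‖ ≤ m / 2 := by
    refine (pow_le_pow_iff_left₀ (norm_nonneg (D - H)) (by positivity) two_ne_zero).1 ?_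
    linarith [hD, div_pow m 2 2]
  have h2 := (neg_le_abs _).trans (ContinuousLinearMap.le_of_opNorm_le _
    (ContinuousLinearMap.le_of_opNorm_le _ h1 T) T)
  simp only [sub_apply] at h2
  linarith [hH T]

end Linearization

section MaximumLikelihood

variable {d n : ℕ} {V : Euc d → ℝ} {J : Euc d →L[ℝ] Euc d} {hatθ : (Fin n → Euc d) → Euc d}
  {L M m : ℝ}

theorem exists_good_event (hn : 0 < n) (hL : 0 < L) (hm : 0 < m)
    (hVc : StrictConvexOn ℝ Set.univ V) (hV : ContDiff ℝ 2 V)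
    (h1 : ∫ x, Real.exp (-(V x)) = 1) (hM : ∀ x, ‖iteratedFDeriv ℝ 2 V x‖ ≤ M)
    (hLip : ∀ x y, ‖iteratedFDeriv ℝ 2 V x - iteratedFDeriv ℝ 2 V y‖ ≤ L * ‖x - y‖)
    (hJ : ∀ u, J u = ∫ x, ⟪gradient V x, u⟫ • gradient V x ∂noiseMeasure V)
    (hJm : ∀ u : Euc d, m * ‖u‖ ^ 2 ≤ ⟪J u, u⟫)
    (hmin : ∀ (x : Fin n → Euc d) (t : Euc d), ∑ j, V (x j - hatθ x) ≤ ∑ j, V (x j - t))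
    {K₁ K₂ K₃ : ℝ} (hK₁ : K₁ = M ^ 2 / (m ^ 2 / 4) + M / (m ^ 2 / (16 * L)) ^ 2)
    (hK₂ : K₂ = (4 / m) ^ 2 * M) (hK₃ : K₃ = ((K₁ + M) / 2 + M ^ 2 + (1 + L) * K₂) / m) :
    ∃ (good : Set (Fin n → Euc d)) (R : ℝ), MeasurableSet good ∧
      (Measure.pi fun _ : Fin n => noiseMeasure V).real goodᶜ ≤ K₁ * (d / n) ∧
      (∀ x ∈ good, ‖hatθ x‖ ≤ R) ∧
      ∫ x in good, ‖hatθ x‖ ^ 2 ∂(Measure.pi fun _ : Fin n => noiseMeasure V) ≤ K₂ * (d / n) ∧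
      ‖∫ x in good, hatθ x ∂(Measure.pi fun _ : Fin n => noiseMeasure V)‖ ≤ K₃ * (d / n) := by
  have := isProbabilityMeasure_noiseMeasure h1
  set P := Measure.pi fun _ : Fin n => noiseMeasure V with hP
  set e := EuclideanSpace.basisFun (Fin d) ℝ with he
  let H : Euc d →L[ℝ] Euc d →L[ℝ] ℝ :=
    ((ContinuousLinearMap.compL ℝ (Euc d) (Euc d) ℝ).flip J).comp (innerSL ℝ)
  have hHu : ∀ w, H w = ∫ x, fderiv ℝ (fderiv ℝ V) x w ∂noiseMeasure V := by
    intro w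
    ext u
    rw [integral_fderiv_fderiv_apply hV hM hJ hm hJm, real_inner_comm]
    rfl
  have hHm : ∀ u, m * ‖u‖ ^ 2 ≤ H u u := fun u => by
    rw [hHu, integral_fderiv_fderiv_apply hV hM hJ hm hJm]
    exact hJm u
  let W : (Fin n → Euc d) → ℝ := fun x =>
    ∑ i, ‖sampleMean (fun z => fderiv ℝ (fderiv ℝ V) z (e i)) x -
      ∫ z, fderiv ℝ (fderiv ℝ V) z (e i) ∂noiseMeasure V‖ ^ 2
  let S : (Fin n → Euc d) → Euc d →L[ℝ] ℝ := fun x => sampleMean (fderiv ℝ V) x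
  have hWH : ∀ x, ‖sampleMean (fderiv ℝ (fderiv ℝ V)) x - H‖ ^ 2 ≤ W x := by
    intro x
    refine (norm_sq_le_sum_basisFun _).trans_eq ?_
    simp only [sub_apply, sampleMean_apply, hHu]
    rfl
  have hW0 : ∀ x, 0 ≤ W x := fun x => Finset.sum_nonneg fun i _ => sq_nonneg _
  have hD : ∀ w, MemLp (fun x => fderiv ℝ (fderiv ℝ V) x w) 2 (noiseMeasure V) :=
    memLp_fderiv_fderiv_apply hV hM
  have hWint : ∀ i, Integrable (fun x => ‖sampleMean (fun z => fderiv ℝ (fderiv ℝ V) z (e i)) x -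
      ∫ z, fderiv ℝ (fderiv ℝ V) z (e i) ∂noiseMeasure V‖ ^ 2) P := fun i =>
    ((memLp_sampleMean (hD _)).sub (memLp_const _)).integrable_norm_pow two_ne_zero
  have hW : Integrable W P := integrable_finsetSum _ fun i _ => hWint i
  have hWi : ∫ x, W x ∂P ≤ M ^ 2 * (d / n) := by
    rw [integral_finsetSum _ fun i _ => hWint i]
    calc _ ≤ ∑ _i : Fin d, (n : ℝ)⁻¹ * M ^ 2 := by
          refine Finset.sum_le_sum fun i _ =>
            (integral_norm_sampleMean_sub_sq_le hn (hD (e i))).trans ?_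
          gcongr
          have h := norm_integral_le_of_norm_le_const (μ := noiseMeasure V) (C := M ^ 2)
            (f := fun z => ‖fderiv ℝ (fderiv ℝ V) z (e i)‖ ^ 2) (ae_of_all _ fun z => by
              rw [norm_pow, norm_norm]
              gcongr
              have := ContinuousLinearMap.le_of_opNorm_le _
                ((norm_fderiv_fderiv V z).trans_le (hM z)) (e i)
              rwa [e.norm_eq_one, mul_one] at this)
          rw [probReal_univ, mul_one] at h
          exact (le_abs_self _).trans h
      _ = _ := by
        rw [Finset.sum_const, Finset.card_univ, Fintype.card_fin, nsmul_eq_mul]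
        ring
  have hL2 := memLp_fderiv hV hJ hm hJm
  have hS : MemLp S 2 P := memLp_sampleMean hL2
  have hS0 : ∫ x, S x ∂P = 0 := by
    rw [← integral_fderiv_eq_zero hV hL2]
    exact integral_sampleMean hn (hL2.integrable one_le_two)
  have hSi : ∫ x, ‖S x‖ ^ 2 ∂P ≤ M * (d / n) := by
    have h := integral_norm_sampleMean_sub_sq_le hn hL2
    simp only [integral_fderiv_eq_zero hV hL2, sub_zero] at h
    refine h.trans ?_
    calc _ ≤ (n : ℝ)⁻¹ * (d * M) := by
          gcongr
          exact integral_norm_fderiv_sq_le hV hM hJ hm hJm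
      _ = _ := by ring
  have hSc : Continuous S := continuous_sampleMean (hV.continuous_fderiv (by norm_num))
  have hWc : Continuous W := by
    refine continuous_finsetSum _ fun i _ => ?_
    have hc : Continuous (fderiv ℝ (fderiv ℝ V)) :=
      (hV.fderiv_right (m := 1) (by norm_num)).continuous_fderiv (by norm_num)
    exact ((continuous_sampleMean (hc.clm_apply continuous_const)).sub
      continuous_const).norm.pow 2
  let good : Set (Fin n → Euc d) := {x | W x ≤ m ^ 2 / 4} ∩ {x | ‖S x‖ < m ^ 2 / (16 * L)}
  have hg : MeasurableSet good :=
    (isClosed_le hWc continuous_const).measurableSet.inter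
      (isOpen_lt hSc.norm continuous_const).measurableSet
  have hTS : ∀ x ∈ good, ‖hatθ x‖ ≤ 4 / m * ‖S x‖ := fun x hx =>
    norm_minimizer_le hn hVc hV hL hm hLip (hmin x)
      (half_mul_sq_le_apply hm hHm ((hWH x).trans hx.1)) hx.2
  have hR : ∀ x ∈ good, ‖hatθ x‖ ≤ 4 / m * (m ^ 2 / (16 * L)) := fun x hx =>
    (hTS x hx).trans (mul_le_mul_of_nonneg_left (le_of_lt hx.2) (by positivity))
  have hbad := measureReal_compl_le (b := m ^ 2 / 4) (c := m ^ 2 / (16 * L)) hg hW hS hW0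
    (by positivity) (by positivity) (fun x h h' => ⟨h, h'⟩) hWi hSi
  have h2 := setIntegral_norm_sq_le hg hS hTS hSi
  rw [← hK₁] at hbad
  rw [← hK₂] at h2
  refine ⟨good, _, hg, hbad, hR, h2, ?_⟩
  rw [hK₃]
  exact norm_setIntegral_minimizer_le hg hm (by positivity) hHm
    (continuous_minimizer hn hVc hV.continuous hmin).measurable hR hS hS0 hW hW0
    (fun x _ => norm_apply_minimizer_sub_le hn hV hL.le hLip (hmin x) (hWH x))
    hWi hSi hbad h2

theorem Texp_eq_integral (hn : 0 < n) (hVc : StrictConvexOn ℝ Set.univ V) (hV : Continuous V)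
    (h1 : ∫ x, Real.exp (-(V x)) = 1)
    (hmin : ∀ (x : Fin n → Euc d) (t : Euc d), ∑ j, V (x j - hatθ x) ≤ ∑ j, V (x j - t))
    {g : Euc d → ℝ} (hg : Continuous g) (θ : Euc d) :
    Texp V n hatθ g θ =
      ∫ x, g (θ + hatθ x) ∂(Measure.pi fun _ : Fin n => noiseMeasure V) := by
  have := isProbabilityMeasure_noiseMeasure h1
  have hθ : Measurable fun x : Euc d => θ + x := measurable_const_add θ
  have hP : sampleMeasure V n θ = (Measure.pi fun _ : Fin n => noiseMeasure V).map
      fun x j => θ + x j :=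
    have : ∀ _ : Fin n, SigmaFinite ((noiseMeasure V).map fun x : Euc d => θ + x) := fun _ =>
      have := Measure.isProbabilityMeasure_map (μ := noiseMeasure V) hθ.aemeasurable
      inferInstance
    (Measure.pi_map_pi fun _ => hθ.aemeasurable).symm
  have hc := hg.comp (continuous_minimizer hn hVc hV hmin)
  rw [Texp, hP]
  refine (integral_map (Measurable.aemeasurable (by fun_prop)) hc.aestronglyMeasurable).trans ?_
  simp only [Function.comp, minimizer_add hn hVc hmin]

theorem iterate_Bop_eq_shiftBias (hn : 0 < n) (hVc : StrictConvexOn ℝ Set.univ V)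
    (hV : Continuous V) (h1 : ∫ x, Real.exp (-(V x)) = 1)
    (hmin : ∀ (x : Fin n → Euc d) (t : Euc d), ∑ j, V (x j - hatθ x) ≤ ∑ j, V (x j - t))
    {g : Euc d → ℝ} {A : ℝ} (hg : Continuous g) (hA : ∀ x, |g x| ≤ A) (j : ℕ) :
    (Bop V n hatθ)^[j] g =
      (shiftBias (Measure.pi fun _ : Fin n => noiseMeasure V) hatθ)^[j] g := by
  have := isProbabilityMeasure_noiseMeasure h1
  have hT := (continuous_minimizer hn hVc hV hmin).measurable
  induction j with
  | zero => rfl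
  | succ j ih =>
    have hj := continuous_iterate_shiftBias
      (P := Measure.pi fun _ : Fin n => noiseMeasure V) hT j hg hA
    rw [Function.iterate_succ_apply', Function.iterate_succ_apply', ih]
    funext θ
    rw [Bop, Texp_eq_integral hn hVc hV h1 hmin hj.1, shiftBias_eq hT hj.1 hj.2]

theorem Texp_biasCorrect_sub (hn : 0 < n) (hVc : StrictConvexOn ℝ Set.univ V)
    (hV : Continuous V) (h1 : ∫ x, Real.exp (-(V x)) = 1)
    (hmin : ∀ (x : Fin n → Euc d) (t : Euc d), ∑ j, V (x j - hatθ x) ≤ ∑ j, V (x j - t))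
    {g : Euc d → ℝ} {A : ℝ} (hg : Continuous g) (hA : ∀ x, |g x| ≤ A) (k : ℕ) (θ : Euc d) :
    Texp V n hatθ (biasCorrect V n hatθ k g) θ - g θ =
      (-1) ^ k * (shiftBias (Measure.pi fun _ : Fin n => noiseMeasure V) hatθ)^[k + 1] g θ := by
  have := isProbabilityMeasure_noiseMeasure h1
  have hT := (continuous_minimizer hn hVc hV hmin).measurable
  set P := Measure.pi fun _ : Fin n => noiseMeasure V with hP
  have hj := fun j => continuous_iterate_shiftBias (P := P) hT j hg hA
  have hbc : biasCorrect V n hatθ k g =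
      fun θ => ∑ j ∈ Finset.range (k + 1), (-1 : ℝ) ^ j * (shiftBias P hatθ)^[j] g θ := by
    funext θ
    simp only [biasCorrect, iterate_Bop_eq_shiftBias hn hVc hV h1 hmin hg hA, hP]
  have hcont : Continuous (biasCorrect V n hatθ k g) := by
    rw [hbc]
    exact continuous_finsetSum _ fun j _ => continuous_const.mul (hj j).1
  rw [Texp_eq_integral hn hVc hV h1 hmin hcont, hbc, integral_finsetSum _ fun j _ =>
    (integrable_comp_shift hT (hj j).1 (hj j).2 θ).const_mul _]
  have hstep : ∀ j, ∫ x, (shiftBias P hatθ)^[j] g (θ + hatθ x) ∂P =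
      (shiftBias P hatθ)^[j + 1] g θ + (shiftBias P hatθ)^[j] g θ := fun j => by
    rw [Function.iterate_succ_apply', shiftBias_eq hT (hj j).1 (hj j).2, sub_add_cancel]
  simp only [← hP, integral_const_mul, hstep]
  clear hbc hcont
  induction k with
  | zero => simp
  | succ k ih =>
    rw [Finset.sum_range_succ, add_sub_right_comm, ih]
    ring

end MaximumLikelihood

/-- Proposition 5.4 / `bounds_on_bias`: bias bound for the bias-corrected
estimator: `|E_θ f_k(θ̂) - f(θ)| ≲ ‖f‖_{C^s} (d/n)^{s/2}` for `s = k+1+ρ`, `k ≥ 1`. -/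
theorem stmt_18 :
    ∃ c : ℝ, 0 < c ∧
      ∀ (L M m ρ : ℝ) (k : ℕ),
        0 < L → 0 < M → 0 < m → 0 < ρ → ρ ≤ 1 → 1 ≤ k →
        ∃ C : ℝ, 0 < C ∧
          ∀ (d n : ℕ) (V f : Euc d → ℝ) (J : Euc d →L[ℝ] Euc d)
            (hatθ : (Fin n → Euc d) → Euc d) (B : ℝ),
            0 < n →
            StrictConvexOn ℝ Set.univ V →
            ContDiff ℝ 2 V →
            (∫ x, Real.exp (-(V x)) = 1) →
            (∀ x, ‖iteratedFDeriv ℝ 2 V x‖ ≤ M) →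
            (∀ x y, ‖iteratedFDeriv ℝ 2 V x - iteratedFDeriv ℝ 2 V y‖ ≤ L * ‖x - y‖) →
            (∀ u, J u = ∫ x, ⟪gradient V x, u⟫ • gradient V x ∂ noiseMeasure V) →
            (∀ u : Euc d, m * ‖u‖ ^ 2 ≤ ⟪J u, u⟫) →
            (∀ (x : Fin n → Euc d) (θ' : Euc d),
              ∑ j, V (x j - hatθ x) ≤ ∑ j, V (x j - θ')) →
            holderCLe (k + 1) ρ f B →
            (d : ℝ) ≤ c * (min (m / M) (m ^ 2 / (L * Real.sqrt M))) ^ 2 * n →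
            ∀ θ : Euc d,
              |Texp V n hatθ (biasCorrect V n hatθ k f) θ - f θ| ≤
                C * B * Real.sqrt ((d : ℝ) / n) ^ ((k : ℝ) + 1 + ρ) := by
  refine ⟨1, one_pos, fun L M m ρ k hL hM0 hm hρ hρ1 _ => ?_⟩
  set K₁ := M ^ 2 / (m ^ 2 / 4) + M / (m ^ 2 / (16 * L)) ^ 2 with hK₁
  set K₂ := (4 / m) ^ 2 * M with hK₂
  set K₃ := ((K₁ + M) / 2 + M ^ 2 + (1 + L) * K₂) / m with hK₃
  have hK₁0 : 0 ≤ K₁ := by positivity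
  have hK₂0 : 0 ≤ K₂ := by positivity
  have hK₃0 : 0 ≤ K₃ := by positivity
  set K := K₁ + K₂ + K₃
  have hK0 : 0 ≤ K := by positivity
  refine ⟨2 ^ (k + 1) * (3 * K + 1) * (2 * K + 1) ^ k, by positivity, ?_⟩
  intro d n V f J hatθ B hn hVc hV h1 hM hLip hJ hJm hmin hf _ θ
  have := isProbabilityMeasure_noiseMeasure h1
  have hT := (continuous_minimizer hn hVc hV.continuous hmin).measurable
  have hfc : Continuous f := hf.1.continuous
  have hB := hf.nonneg
  have hfB : ∀ x, |f x| ≤ B := fun x => by simpa using hf.2.1 0 (Nat.zero_le _) x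
  rw [Texp_biasCorrect_sub hn hVc hV.continuous h1 hmin hfc hfB, abs_mul, abs_pow, abs_neg,
    abs_one, one_pow, one_mul]
  have hn' : (0 : ℝ) < n := by exact_mod_cast hn
  rcases Nat.eq_zero_or_pos d with rfl | hd
  · have h0 : shiftBias (Measure.pi fun _ : Fin n => noiseMeasure V) hatθ
        ((shiftBias (Measure.pi fun _ : Fin n => noiseMeasure V) hatθ)^[k] f) θ = 0 := by
      rw [shiftBias]
      simp [Subsingleton.elim (hatθ _) 0]
    rw [Function.iterate_succ_apply', h0, abs_zero]
    positivity
  have hd' : (0 : ℝ) < d := by exact_mod_cast hd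
  have hδ : (0 : ℝ) < d / n := by positivity
  rcases le_total ((d : ℝ) / n) 1 with hδ1 | hδ1
  · obtain ⟨good, R, hg, hbad, hR, h2, h3⟩ :=
      exists_good_event hn hL hm hVc hV h1 hM hLip hJ hJm hmin hK₁ hK₂ hK₃
    have hle : ∀ {K' : ℝ}, K' ≤ K → K' * ((d : ℝ) / n) ≤ K * (d / n) := fun h => by gcongr
    exact abs_iterate_shiftBias_le_of_holder hf hρ hρ1 hT hg hδ hδ1 hK0
      (hbad.trans (hle (by linarith))) hR (h2.trans (hle (by linarith)))
      (h3.trans (hle (by linarith))) θ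
  · refine ((continuous_iterate_shiftBias hT (k + 1) hfc hfB).2 θ).trans ?_
    have hs : 1 ≤ √((d : ℝ) / n) ^ ((k : ℝ) + 1 + ρ) :=
      Real.one_le_rpow (Real.one_le_sqrt.2 hδ1) (by positivity)
    have hC : (1 : ℝ) ≤ (3 * K + 1) * (2 * K + 1) ^ k :=
      one_le_mul_of_one_le_of_one_le (by linarith) (one_le_pow₀ (by linarith))
    calc 2 ^ (k + 1) * B = 2 ^ (k + 1) * 1 * B * 1 := by ring
      _ ≤ 2 ^ (k + 1) * ((3 * K + 1) * (2 * K + 1) ^ k) * B *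
          √((d : ℝ) / n) ^ ((k : ℝ) + 1 + ρ) := by gcongr
      _ = _ := by ring
end
end

section
/- Under Assumption (A), let Π be a probability measure on ℝ^d with Lebesgue density π satisfying condition (P1) or (P2) and with finite Fisher information matrix 𝓙_π = ∫ π'(θ) ⊗ π'(θ)/π(θ) dθ. Then for every δ > 0: the infimum over all estimators θ̂_n = θ̂_n(X_1,…,X_n) of ∫ E_θ‖θ̂_n − θ‖² Π_δ(dθ) is at least (1/n)·tr( (𝓘 + 𝓙_π/(δ²n))^{-1} ), where Π_δ is the probability measure with density π_δ(θ) = δ^{-d}·π(δ^{-1}θ). -/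
open MeasureTheory Real
open scoped RealInnerProductSpace BigOperators ENNReal NNReal

noncomputable section

/-- Condition (P1) on a prior density: `π = e^{-W}` with `W` twice differentiable with bounded
and Lipschitz Hessian. -/
def condP1 {d : ℕ} (pr : Euc d → ℝ) : Prop :=
  ∃ W : Euc d → ℝ,
    (∀ θ, pr θ = Real.exp (-(W θ))) ∧ ContDiff ℝ 2 W ∧
      (∃ K, ∀ x, ‖iteratedFDeriv ℝ 2 W x‖ ≤ K) ∧
      (∃ K, ∀ x y, ‖iteratedFDeriv ℝ 2 W x - iteratedFDeriv ℝ 2 W y‖ ≤ K * ‖x - y‖)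

/-- Condition (P2) on a prior density: bounded support, twice differentiable, with `π, π', π''`
bounded and Lipschitz. -/
def condP2 {d : ℕ} (pr : Euc d → ℝ) : Prop :=
  (∃ R, ∀ x, pr x ≠ 0 → ‖x‖ ≤ R) ∧ ContDiff ℝ 2 pr ∧
    ∀ j : ℕ, j ≤ 2 →
      (∃ K, ∀ x, ‖iteratedFDeriv ℝ j pr x‖ ≤ K) ∧
      (∃ K, ∀ x y, ‖iteratedFDeriv ℝ j pr x - iteratedFDeriv ℝ j pr y‖ ≤ K * ‖x - y‖)

theorem pi_withDensity_ofReal {ι α : Type*} [Fintype ι] [MeasurableSpace α] (μ : Measure α)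
    [SigmaFinite μ] {g : α → ℝ} (hg : Integrable g μ) (hg0 : ∀ x, 0 ≤ g x) :
    Measure.pi (fun _ : ι => μ.withDensity fun x => ENNReal.ofReal (g x)) =
      (Measure.pi fun _ : ι => μ).withDensity fun x => ENNReal.ofReal (∏ i, g (x i)) := by
  have : IsFiniteMeasure (μ.withDensity fun x => ENNReal.ofReal (g x)) :=
    isFiniteMeasure_withDensity_ofReal hg.2
  refine Measure.pi_eq fun s hs => ?_
  rw [withDensity_apply _ (MeasurableSet.univ_pi hs), Measure.restrict_pi_pi,
    ← ofReal_integral_eq_lintegral_ofReal (Integrable.fintype_prod fun i => hg.restrict)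
      (Filter.Eventually.of_forall fun x => Finset.prod_nonneg fun i _ => hg0 _),
    integral_fintype_prod_eq_prod (fun _ => g),
    ENNReal.ofReal_prod_of_nonneg fun i _ => integral_nonneg hg0]
  refine Finset.prod_congr rfl fun i _ => ?_
  rw [withDensity_apply _ (hs i), ofReal_integral_eq_lintegral_ofReal hg.restrict
    (Filter.Eventually.of_forall hg0)]

/-- **Scalar van Trees inequality**: `f` is a joint density of parameter and observation, and `σ`
is the score of `f` in the direction `w` of the parameter. -/
theorem van_trees_scalar {E X : Type*} [NormedAddCommGroup E] [NormedSpace ℝ E]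
    [FiniteDimensional ℝ E] [MeasurableSpace E] [BorelSpace E] [MeasurableSpace X]
    (μ : Measure E) [μ.IsAddHaarMeasure] (ν : Measure X) [SFinite ν]
    {f σ : E × X → ℝ} {t : X → ℝ} (ℓ : E →L[ℝ] ℝ) (w : E)
    (hf0 : ∀ z, 0 ≤ f z) (hf : Integrable f (μ.prod ν)) (hf1 : ∫ z, f z ∂μ.prod ν = 1)
    (hσ : Measurable σ) (ht : Measurable t)
    (hσf : Integrable (fun z => σ z ^ 2 * f z) (μ.prod ν))
    (hd : ∀ x θ, HasLineDerivAt ℝ (fun θ => f (θ, x)) (σ (θ, x) * f (θ, x)) θ w) :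
    ENNReal.ofReal (2 * ℓ w - ∫ z, σ z ^ 2 * f z ∂μ.prod ν) ≤
      ∫⁻ z, ENNReal.ofReal ((t z.2 - ℓ z.1) ^ 2 * f z) ∂μ.prod ν := by
  by_cases htop : ∫⁻ z, ENNReal.ofReal ((t z.2 - ℓ z.1) ^ 2 * f z) ∂μ.prod ν = ∞
  · rw [htop]; exact le_top
  set Φ : E × X → ℝ := fun z => t z.2 - ℓ z.1
  have hΦ : Measurable Φ :=
    (ht.comp measurable_snd).sub (ℓ.continuous.measurable.comp measurable_fst)
  have hΦ0 : ∀ z, 0 ≤ Φ z ^ 2 * f z := fun z => mul_nonneg (sq_nonneg _) (hf0 z)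
  have hΦ2 : Integrable (fun z => Φ z ^ 2 * f z) (μ.prod ν) :=
    ⟨(hΦ.pow_const 2).aestronglyMeasurable.mul hf.1,
      (hasFiniteIntegral_iff_ofReal (Filter.Eventually.of_forall hΦ0)).2
        (lt_top_iff_ne_top.2 htop)⟩
  have hΦ1 : Integrable (fun z => Φ z * f z) (μ.prod ν) := by
    refine (hΦ2.add hf).mono' (hΦ.aestronglyMeasurable.mul hf.1)
      (Filter.Eventually.of_forall fun z => ?_)
    rw [norm_mul, norm_eq_abs, norm_eq_abs, abs_of_nonneg (hf0 z)]
    have h : |Φ z| ≤ Φ z ^ 2 + 1 := by rw [← sq_abs]; nlinarith [sq_nonneg (|Φ z| - 1)]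
    simpa [add_mul] using mul_le_mul_of_nonneg_right h (hf0 z)
  have hΦσ : Integrable (fun z => Φ z * (σ z * f z)) (μ.prod ν) := by
    refine (hΦ2.add hσf).mono'
      (hΦ.aestronglyMeasurable.mul (hσ.aestronglyMeasurable.mul hf.1))
      (Filter.Eventually.of_forall fun z => ?_)
    rw [← mul_assoc, norm_mul, norm_eq_abs, norm_eq_abs, abs_of_nonneg (hf0 z), abs_mul]
    have h : |Φ z| * |σ z| ≤ Φ z ^ 2 + σ z ^ 2 := by
      rw [← sq_abs (Φ z), ← sq_abs (σ z)]
      nlinarith [sq_nonneg (|Φ z| - |σ z|), sq_nonneg (Φ z), sq_nonneg (σ z)]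
    simpa [add_mul] using mul_le_mul_of_nonneg_right h (hf0 z)
  have key : ∫ z, Φ z * (σ z * f z) ∂μ.prod ν = ℓ w := by
    calc ∫ z, Φ z * (σ z * f z) ∂μ.prod ν
        = ∫ x, ∫ θ, Φ (θ, x) * (σ (θ, x) * f (θ, x)) ∂μ ∂ν := integral_prod_symm _ hΦσ
      _ = ∫ x, ∫ θ, ℓ w * f (θ, x) ∂μ ∂ν := by
          refine integral_congr_ae ?_
          filter_upwards [hΦσ.prod_left_ae, hΦ1.prod_left_ae, hf.prod_left_ae] with x h1 h2 h3
          have := integral_bilinear_hasLineDerivAt_right_eq_neg_left_of_integrable (μ := μ)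
            (B := ContinuousLinearMap.mul ℝ ℝ) (f := fun θ => Φ (θ, x)) (f' := fun _ => -ℓ w)
            (g := fun θ => f (θ, x)) (g' := fun θ => σ (θ, x) * f (θ, x)) (v := w)
            (by simpa using h3.const_mul (-ℓ w)) (by simpa using h1) (by simpa using h2)
            (fun θ _ => (ℓ.hasFDerivAt.const_sub (t x)).hasLineDerivAt w)
            (fun θ _ => hd x θ)
          simpa [integral_neg] using this
      _ = ∫ z, ℓ w * f z ∂μ.prod ν := (integral_prod_symm _ (hf.const_mul _)).symm
      _ = ℓ w := by rw [integral_const_mul, hf1, mul_one]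
  have hpos : 0 ≤ ∫ z, (Φ z ^ 2 * f z - 2 * (Φ z * (σ z * f z)) + σ z ^ 2 * f z) ∂μ.prod ν :=
    integral_nonneg fun z => by
      have := mul_nonneg (sq_nonneg (Φ z - σ z)) (hf0 z)
      simp only [Pi.zero_apply]
      nlinarith
  rw [integral_add (by exact hΦ2.sub (hΦσ.const_mul 2)) hσf, integral_sub hΦ2 (hΦσ.const_mul 2),
    integral_const_mul, key] at hpos
  rw [← ofReal_integral_eq_lintegral_ofReal hΦ2 (Filter.Eventually.of_forall hΦ0)]
  exact ENNReal.ofReal_le_ofReal (by linarith)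

theorem measurePreserving_prod_sub {E X : Type*} [MeasurableSpace E] [MeasurableSpace X]
    [AddCommGroup X] [MeasurableSub₂ X] [MeasurableAdd X] (μ : Measure E) (ν : Measure X)
    [SFinite μ] [SFinite ν] [ν.IsAddRightInvariant] {c : E → X} (hc : Measurable c) :
    MeasurePreserving (fun z : E × X => (z.1, z.2 - c z.1)) (μ.prod ν) (μ.prod ν) :=
  (MeasurePreserving.id μ).skew_product (measurable_snd.sub (hc.comp measurable_fst))
    (Filter.Eventually.of_forall fun θ => (measurePreserving_sub_right ν (c θ)).map_eq)

/-- If `p` is a density with score `s` and `q` a density with score `g`, then the Fisher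
information of the joint density `p (x - c θ) * q θ` is the sum of the informations. -/
theorem integral_joint_score_sq {E X : Type*} [MeasurableSpace E] [MeasurableSpace X]
    [AddCommGroup X] [MeasurableSub₂ X] [MeasurableAdd X] (μ : Measure E) (ν : Measure X)
    [SFinite μ] [SFinite ν] [ν.IsAddRightInvariant] {c : E → X} (hc : Measurable c)
    {p s : X → ℝ} {q g : E → ℝ}
    (hp : Integrable p ν) (hp1 : ∫ x, p x ∂ν = 1)
    (hsp : Integrable (fun x => s x * p x) ν) (hsp0 : ∫ x, s x * p x ∂ν = 0)
    (hs2p : Integrable (fun x => s x ^ 2 * p x) ν)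
    (hq : Integrable q μ) (hq1 : ∫ θ, q θ ∂μ = 1) (hq0 : ∀ θ, 0 ≤ q θ) (hg : Measurable g)
    (hg2q : Integrable (fun θ => g θ ^ 2 * q θ) μ) :
    Integrable (fun z : E × X => p (z.2 - c z.1) * q z.1) (μ.prod ν) ∧
    ∫ z : E × X, p (z.2 - c z.1) * q z.1 ∂μ.prod ν = 1 ∧
    Integrable (fun z : E × X => (s (z.2 - c z.1) + g z.1) ^ 2 * (p (z.2 - c z.1) * q z.1))
      (μ.prod ν) ∧
    ∫ z : E × X, (s (z.2 - c z.1) + g z.1) ^ 2 * (p (z.2 - c z.1) * q z.1) ∂μ.prod ν =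
      ∫ x, s x ^ 2 * p x ∂ν + ∫ θ, g θ ^ 2 * q θ ∂μ := by
  have hΨ := measurePreserving_prod_sub μ ν hc
  have hgq : Integrable (fun θ => g θ * q θ) μ := by
    refine (hg2q.add hq).mono' (hg.aestronglyMeasurable.mul hq.1)
      (Filter.Eventually.of_forall fun θ => ?_)
    rw [norm_mul, norm_eq_abs, norm_eq_abs, abs_of_nonneg (hq0 θ)]
    have h : |g θ| ≤ g θ ^ 2 + 1 := by rw [← sq_abs]; nlinarith [sq_nonneg (|g θ| - 1)]
    simpa [add_mul] using mul_le_mul_of_nonneg_right h (hq0 θ)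
  have transfer : ∀ G : E × X → ℝ, Integrable G (μ.prod ν) →
      Integrable (fun z : E × X => G (z.1, z.2 - c z.1)) (μ.prod ν) ∧
      ∫ z : E × X, G (z.1, z.2 - c z.1) ∂μ.prod ν = ∫ z, G z ∂μ.prod ν := fun G hG =>
    ⟨hΨ.integrable_comp_of_integrable hG, by
      rw [← integral_map hΨ.measurable.aemeasurable (by rw [hΨ.map_eq]; exact hG.1), hΨ.map_eq]⟩
  have e0 : Integrable (fun z : E × X => q z.1 * p z.2) (μ.prod ν) := hq.mul_prod hp
  have e1 : Integrable (fun z : E × X => q z.1 * (s z.2 ^ 2 * p z.2)) (μ.prod ν) :=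
    hq.mul_prod hs2p
  have e2 : Integrable (fun z : E × X => (g z.1 * q z.1) * (s z.2 * p z.2)) (μ.prod ν) :=
    hgq.mul_prod hsp
  have e3 : Integrable (fun z : E × X => (g z.1 ^ 2 * q z.1) * p z.2) (μ.prod ν) :=
    hg2q.mul_prod hp
  have eq : (fun z : E × X => (s z.2 + g z.1) ^ 2 * (p z.2 * q z.1)) = fun z =>
      q z.1 * (s z.2 ^ 2 * p z.2) + 2 * ((g z.1 * q z.1) * (s z.2 * p z.2)) +
        (g z.1 ^ 2 * q z.1) * p z.2 := by ext z; ring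
  have e12 := e1.add (e2.const_mul 2)
  have eint : Integrable (fun z : E × X => (s z.2 + g z.1) ^ 2 * (p z.2 * q z.1)) (μ.prod ν) := by
    rw [eq]; exact e12.add e3
  have h0 := transfer _ e0
  have h1 := transfer _ eint
  refine ⟨by simpa only [mul_comm] using h0.1, ?_, h1.1, h1.2.trans ?_⟩
  · simp_rw [mul_comm (p _)]
    rw [h0.2, integral_prod_mul q p, hq1, hp1, one_mul]
  · rw [eq, integral_add (by exact e12) e3, integral_add e1 (e2.const_mul 2), integral_const_mul,
      integral_prod_mul q fun x => s x ^ 2 * p x,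
      integral_prod_mul (fun θ => g θ * q θ) fun x => s x * p x,
      integral_prod_mul (fun θ => g θ ^ 2 * q θ) p, hq1, hp1, hsp0]
    ring

theorem lintegral_sampleMeasure {d n : ℕ} {V : Euc d → ℝ} (hV : Continuous V)
    (h1 : ∫ x, Real.exp (-(V x)) = 1) (θ : Euc d) {g : (Fin n → Euc d) → ℝ≥0∞}
    (hg : Measurable g) :
    ∫⁻ x, g x ∂sampleMeasure V n θ =
      ∫⁻ x, g x * ENNReal.ofReal (∏ i, Real.exp (-(V (x i - θ)))) := by
  have h_int : Integrable fun x => Real.exp (-(V x)) :=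
    not_imp_comm.1 integral_undef (by rw [h1]; exact one_ne_zero)
  have : IsFiniteMeasure (noiseMeasure V) := isFiniteMeasure_withDensity_ofReal h_int.2
  have hm : Measurable fun x : Fin n → Euc d => ENNReal.ofReal (∏ i, Real.exp (-(V (x i)))) := by
    fun_prop
  have hshift : Measurable fun x : Fin n → Euc d => fun i => θ + x i := by fun_prop
  have hpi : sampleMeasure V n θ =
      (Measure.pi fun _ : Fin n => noiseMeasure V).map fun x i => θ + x i :=
    (Measure.pi_map_pi (f := fun (_ : Fin n) x => θ + x) fun _ =>
      (measurable_const_add θ).aemeasurable).symm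
  rw [hpi, lintegral_map hg hshift]
  unfold noiseMeasure
  rw [pi_withDensity_ofReal volume h_int fun x => (Real.exp_pos _).le, ← volume_pi,
    lintegral_withDensity_eq_lintegral_mul _ hm (show Measurable fun x : Fin n → Euc d => g fun i => θ + x i from hg.comp hshift),
    ← lintegral_sub_right_eq_self _ (fun _ : Fin n => θ)]
  refine lintegral_congr fun x => ?_
  simp [mul_comm]

theorem noise_score {d : ℕ} {V : Euc d → ℝ} (hV : ContDiff ℝ 2 V)
    (h1 : ∫ x, Real.exp (-(V x)) = 1) (w : Euc d)
    (h2 : Integrable (fun x => ⟪gradient V x, w⟫ ^ 2) (noiseMeasure V)) :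
    IsProbabilityMeasure (noiseMeasure V) ∧ MemLp (fun x => ⟪gradient V x, w⟫) 2 (noiseMeasure V) ∧
      ∫ x, ⟪gradient V x, w⟫ ∂noiseMeasure V = 0 := by
  have h_int : Integrable fun x => Real.exp (-(V x)) :=
    not_imp_comm.1 integral_undef (by rw [h1]; exact one_ne_zero)
  have hprob : IsProbabilityMeasure (noiseMeasure V) := ⟨by
    rw [noiseMeasure, withDensity_apply _ .univ, setLIntegral_univ,
      ← ofReal_integral_eq_lintegral_ofReal h_int
        (Filter.Eventually.of_forall fun x => (Real.exp_pos _).le), h1, ENNReal.ofReal_one]⟩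
  have hVc : Continuous V := hV.continuous
  have hdV : Continuous fun x => ⟪gradient V x, w⟫ := by
    simp_rw [gradient]
    simp only [InnerProductSpace.toDual_symm_apply]
    exact (hV.continuous_fderiv (by norm_num)).clm_apply continuous_const
  have hL : MemLp (fun x => ⟪gradient V x, w⟫) 2 (noiseMeasure V) :=
    (memLp_two_iff_integrable_sq hdV.aestronglyMeasurable).2 h2
  refine ⟨hprob, hL, ?_⟩
  have hm : Measurable fun x => ENNReal.ofReal (Real.exp (-(V x))) := by fun_prop
  have hI := hL.integrable (by norm_num)
  rw [noiseMeasure, integrable_withDensity_iff_integrable_smul' hm (by simp)] at hI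
  rw [noiseMeasure, integral_withDensity_eq_integral_toReal_smul hm (by simp)]
  simp only [ENNReal.toReal_ofReal (Real.exp_pos _).le, smul_eq_mul] at hI ⊢
  have hd : ∀ x, HasLineDerivAt ℝ (fun x => Real.exp (-(V x)))
      (-(Real.exp (-(V x)) * ⟪gradient V x, w⟫)) x w := fun x => by
    have := ((hV.differentiable (by norm_num) x).hasGradientAt.hasFDerivAt.neg.exp).hasLineDerivAt w
    simpa using this
  have := integral_bilinear_hasLineDerivAt_right_eq_neg_left_of_integrable (μ := volume)
    (B := ContinuousLinearMap.mul ℝ ℝ) (f := fun _ : Euc d => (1 : ℝ)) (f' := fun _ => 0)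
    (g := fun x => Real.exp (-(V x))) (v := w) (by simp) (by simpa using hI.neg)
    (by simpa using h_int) (fun x _ => by simpa using (hasFDerivAt_const (1 : ℝ) x).hasLineDerivAt w)
    (fun x _ => hd x)
  simpa [integral_neg] using this

theorem sample_score {ι Ω : Type*} [Fintype ι] [MeasurableSpace Ω] (μ : Measure Ω)
    [IsProbabilityMeasure μ] {a : Ω → ℝ} (ha : MemLp a 2 μ) (ha0 : ∫ x, a x ∂μ = 0) :
    MemLp (fun x : ι → Ω => ∑ i, a (x i)) 2 (Measure.pi fun _ => μ) ∧
      ∫ x : ι → Ω, ∑ i, a (x i) ∂(Measure.pi fun _ => μ) = 0 ∧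
      ∫ x : ι → Ω, (∑ i, a (x i)) ^ 2 ∂(Measure.pi fun _ => μ) =
        Fintype.card ι * ∫ x, a x ^ 2 ∂μ := by
  have hi : ∀ i : ι, MemLp (fun x : ι → Ω => a (x i)) 2 (Measure.pi fun _ => μ) := fun i =>
    ha.comp_measurePreserving (measurePreserving_eval _ i)
  have hS : MemLp (fun x : ι → Ω => ∑ i, a (x i)) 2 (Measure.pi fun _ => μ) :=
    memLp_finsetSum _ fun i _ => hi i
  have h0 : ∫ x : ι → Ω, ∑ i, a (x i) ∂(Measure.pi fun _ => μ) = 0 := by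
    rw [integral_finsetSum _ fun i _ => (hi i).integrable (by norm_num)]
    refine Finset.sum_eq_zero fun i _ => ?_
    rw [integral_comp_eval (μ := fun _ : ι => μ) ha.aestronglyMeasurable, ha0]
  refine ⟨hS, h0, ?_⟩
  have hv := ProbabilityTheory.variance_sum_pi (μ := fun _ : ι => μ) (X := fun _ : ι => a)
    fun _ => ha
  have e : (∑ i : ι, fun ω : ι → Ω => a (ω i)) = fun x => ∑ i, a (x i) := by ext; simp
  rw [e, ProbabilityTheory.variance_of_integral_eq_zero hS.aestronglyMeasurable.aemeasurable h0,
    ProbabilityTheory.variance_of_integral_eq_zero ha.aestronglyMeasurable.aemeasurable ha0] at hv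
  simpa using hv

theorem location_score {d : ℕ} (n : ℕ) {V : Euc d → ℝ} (hV : ContDiff ℝ 2 V)
    (h1 : ∫ x, Real.exp (-(V x)) = 1) (w : Euc d)
    (h2 : Integrable (fun x => ⟪gradient V x, w⟫ ^ 2) (noiseMeasure V)) :
    let p : (Fin n → Euc d) → ℝ := fun x => ∏ i, Real.exp (-(V (x i)))
    let s : (Fin n → Euc d) → ℝ := fun x => ∑ i, ⟪gradient V (x i), w⟫
    Integrable p ∧ ∫ x, p x = 1 ∧ Integrable (fun x => s x * p x) ∧ ∫ x, s x * p x = 0 ∧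
      Integrable (fun x => s x ^ 2 * p x) ∧
      ∫ x, s x ^ 2 * p x = n * ∫ x, ⟪gradient V x, w⟫ ^ 2 ∂noiseMeasure V := by
  intro p s
  have h_int : Integrable fun x => Real.exp (-(V x)) :=
    not_imp_comm.1 integral_undef (by rw [h1]; exact one_ne_zero)
  obtain ⟨hprob, hL, h0⟩ := noise_score hV h1 w h2
  obtain ⟨hS, hS0, hS2⟩ := sample_score (ι := Fin n) (noiseMeasure V) hL h0
  have hVc : Continuous V := hV.continuous
  have hp0 : ∀ x, 0 ≤ p x := fun x => Finset.prod_nonneg fun i _ => (Real.exp_pos _).le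
  have hpm : Measurable fun x : Fin n → Euc d => ENNReal.ofReal (p x) := by
    simp only [p]; fun_prop
  have hpi : Measure.pi (fun _ : Fin n => noiseMeasure V) =
      volume.withDensity fun x => ENNReal.ofReal (p x) :=
    pi_withDensity_ofReal volume h_int fun x => (Real.exp_pos _).le
  have hI : ∀ h : (Fin n → Euc d) → ℝ, Integrable h (Measure.pi fun _ => noiseMeasure V) →
      Integrable fun x => h x * p x := fun h hh => by
    rw [hpi, integrable_withDensity_iff_integrable_smul' hpm (by simp)] at hh
    simpa only [ENNReal.toReal_ofReal (hp0 _), smul_eq_mul, mul_comm] using hh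
  have hE : ∀ h : (Fin n → Euc d) → ℝ, ∫ x, h x * p x =
      ∫ x, h x ∂(Measure.pi fun _ => noiseMeasure V) := fun h => by
    rw [hpi, integral_withDensity_eq_integral_toReal_smul hpm (by simp)]
    simp only [ENNReal.toReal_ofReal (hp0 _), smul_eq_mul, mul_comm]
  refine ⟨by simpa using hI (fun _ => 1) (integrable_const _), by simpa using hE fun _ => 1,
    hI s (hS.integrable (by norm_num)), (hE s).trans hS0, hI _ hS.integrable_sq, ?_⟩
  rw [hE, hS2, Fintype.card_fin]

theorem prior_score {d : ℕ} {δ : ℝ} (hδ : 0 < δ) {pr : Euc d → ℝ} (hpr : ContDiff ℝ 2 pr)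
    (hpr0 : ∀ θ, 0 ≤ pr θ) (hpr1 : ∫ θ, pr θ = 1) (w : Euc d)
    (h2 : Integrable fun θ => ⟪gradient pr θ, w⟫ * ⟪gradient pr θ, w⟫ / pr θ) :
    let q : Euc d → ℝ := fun θ => δ⁻¹ ^ d * pr (δ⁻¹ • θ)
    let g : Euc d → ℝ := fun θ => δ⁻¹ * (⟪gradient pr (δ⁻¹ • θ), w⟫ / pr (δ⁻¹ • θ))
    Integrable q ∧ ∫ θ, q θ = 1 ∧ Measurable g ∧ Integrable (fun θ => g θ ^ 2 * q θ) ∧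
      ∫ θ, g θ ^ 2 * q θ =
        (δ ^ 2)⁻¹ * ∫ θ, ⟪gradient pr θ, w⟫ * ⟪gradient pr θ, w⟫ / pr θ ∧
      ∀ θ, HasLineDerivAt ℝ q (g θ * q θ) θ w := by
  intro q g
  have hδ' : δ⁻¹ ≠ 0 := inv_ne_zero hδ.ne'
  have h_int : Integrable pr := not_imp_comm.1 integral_undef (by rw [hpr1]; exact one_ne_zero)
  have hscale : ∀ F : Euc d → ℝ, ∫ θ, δ⁻¹ ^ d * F (δ⁻¹ • θ) = ∫ θ, F θ := fun F => by
    rw [integral_const_mul, Measure.integral_comp_inv_smul_of_nonneg _ _ hδ.le,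
      finrank_euclideanSpace_fin, smul_eq_mul, ← mul_assoc, ← mul_pow, inv_mul_cancel₀ hδ.ne',
      one_pow, one_mul]
  have hzero : ∀ θ, pr θ = 0 → gradient pr θ = 0 := fun θ h => by
    have : IsLocalMin pr θ := Filter.Eventually.of_forall fun y => by rw [h]; exact hpr0 y
    rw [gradient, this.fderiv_eq_zero, map_zero]
  have hg2q : (fun θ => g θ ^ 2 * q θ) = fun θ => δ⁻¹ ^ d * ((δ ^ 2)⁻¹ *
      (⟪gradient pr (δ⁻¹ • θ), w⟫ * ⟪gradient pr (δ⁻¹ • θ), w⟫ / pr (δ⁻¹ • θ))) := by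
    ext θ
    by_cases h : pr (δ⁻¹ • θ) = 0
    · simp [g, q, h]
    · simp only [g, q]; field_simp
  have hdm : Continuous fun θ => ⟪gradient pr θ, w⟫ := by
    simp_rw [gradient]
    simp only [InnerProductSpace.toDual_symm_apply]
    exact (hpr.continuous_fderiv (by norm_num)).clm_apply continuous_const
  have hprm : Measurable pr := hpr.continuous.measurable
  refine ⟨(h_int.comp_smul hδ').const_mul _, (hscale pr).trans hpr1, ?_, ?_, ?_, fun θ => ?_⟩
  · have := hdm.measurable
    exact ((this.div hprm).comp (measurable_const_smul δ⁻¹)).const_mul _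
  · rw [hg2q]
    exact ((h2.comp_smul hδ').const_mul _).const_mul _
  · rw [hg2q, hscale fun θ => (δ ^ 2)⁻¹ * (⟪gradient pr θ, w⟫ * ⟪gradient pr θ, w⟫ / pr θ),
      integral_const_mul]
  · have hd : HasFDerivAt (fun θ : Euc d => δ⁻¹ • θ) (δ⁻¹ • ContinuousLinearMap.id ℝ (Euc d)) θ :=
      (hasFDerivAt_id θ).const_smul δ⁻¹
    have := (((hpr.differentiable (by norm_num) (δ⁻¹ • θ)).hasGradientAt.hasFDerivAt.comp θ
      hd).const_mul (δ⁻¹ ^ d)).hasLineDerivAt w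
    convert! this using 1
    by_cases h : pr (δ⁻¹ • θ) = 0
    · simp [g, q, h, hzero _ h]
    · have hc : ∀ a b c e : ℝ, a ≠ 0 → c * (b / a) * (e * a) = e * (c * b) := fun a b c e ha => by
        field_simp
      simp only [g, q]
      rw [hc _ _ _ _ h]
      simp

theorem hasLineDerivAt_location {d n : ℕ} {V : Euc d → ℝ} (hV : ContDiff ℝ 2 V)
    (x : Fin n → Euc d) (θ w : Euc d) :
    HasLineDerivAt ℝ (fun θ => ∏ i, Real.exp (-(V (x i - θ))))
      ((∑ i, ⟪gradient V (x i - θ), w⟫) * ∏ i, Real.exp (-(V (x i - θ)))) θ w := by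
  simp_rw [← Real.exp_sum]
  have h : ∀ i, HasFDerivAt (fun θ => -(V (x i - θ)))
      (InnerProductSpace.toDual ℝ _ (gradient V (x i - θ))) θ := fun i => by
    have := ((hV.differentiable (by norm_num) (x i - θ)).hasGradientAt.hasFDerivAt.comp θ
      ((hasFDerivAt_id θ).const_sub (x i))).neg
    convert! this using 1
    ext; simp
  have := ((HasFDerivAt.fun_sum (u := Finset.univ) fun i _ => h i).exp).hasLineDerivAt w
  simpa [_root_.sum_apply, mul_comm] using this

/-- The van Trees inequality for estimating `⟪e, θ⟫` in a location model with a rescaled prior. -/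
theorem van_trees_location {d n : ℕ} {δ : ℝ} (hδ : 0 < δ) {V pr : Euc d → ℝ}
    (hV : ContDiff ℝ 2 V) (h1 : ∫ x, Real.exp (-(V x)) = 1)
    (hpr : ContDiff ℝ 2 pr) (hpr0 : ∀ θ, 0 ≤ pr θ) (hpr1 : ∫ θ, pr θ = 1) (e w : Euc d)
    (hIV : Integrable (fun x => ⟪gradient V x, w⟫ ^ 2) (noiseMeasure V))
    (hIpr : Integrable fun θ => ⟪gradient pr θ, w⟫ * ⟪gradient pr θ, w⟫ / pr θ)
    {t : (Fin n → Euc d) → ℝ} (ht : Measurable t) :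
    ENNReal.ofReal (2 * ⟪e, w⟫ - (n * ∫ x, ⟪gradient V x, w⟫ ^ 2 ∂noiseMeasure V +
        (δ ^ 2)⁻¹ * ∫ θ, ⟪gradient pr θ, w⟫ * ⟪gradient pr θ, w⟫ / pr θ)) ≤
      ∫⁻ z : Euc d × (Fin n → Euc d), ENNReal.ofReal ((t z.2 - ⟪e, z.1⟫) ^ 2 *
        ((∏ i, Real.exp (-(V (z.2 i - z.1)))) * (δ⁻¹ ^ d * pr (δ⁻¹ • z.1)))) := by
  obtain ⟨a1, a2, a3, a4, a5, a6⟩ := location_score n hV h1 w hIV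
  obtain ⟨b1, b2, b3, b4, b5, b6⟩ := prior_score hδ hpr hpr0 hpr1 w hIpr
  have hq0 : ∀ θ, 0 ≤ δ⁻¹ ^ d * pr (δ⁻¹ • θ) := fun θ => by have := hpr0 (δ⁻¹ • θ); positivity
  have hc : Measurable fun (θ : Euc d) (_ : Fin n) => θ := by fun_prop
  obtain ⟨c1, c2, c3, c4⟩ := integral_joint_score_sq volume volume hc a1 a2 a3 a4 a5 b1 b2 hq0
    b3 b4
  have hdV : Continuous fun x => ⟪gradient V x, w⟫ := by
    simp_rw [gradient]
    simp only [InnerProductSpace.toDual_symm_apply]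
    exact (hV.continuous_fderiv (by norm_num)).clm_apply continuous_const
  rw [← a6, ← b5, ← c4]
  refine van_trees_scalar volume volume (innerSL ℝ e) w
    (fun z => mul_nonneg (Finset.prod_nonneg fun i _ => (Real.exp_pos _).le) (hq0 _))
    c1 c2 ?_ ht c3 fun x θ => ?_
  · refine Measurable.add ?_ (b3.comp measurable_fst)
    refine Finset.measurable_sum _ fun i _ => ?_
    exact hdV.measurable.comp (by fun_prop)
  · refine HasDerivAt.congr_deriv (HasDerivAt.mul (hasLineDerivAt_location hV x θ w) (b6 θ)) ?_
    simp
    ring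

/-- Theorem 6.2 / `theorem:van:Trees:theta`: equivariant van Trees
inequality, i.e. a Bayes risk lower bound for the estimation of the location parameter. -/
theorem stmt_19 :
    ∀ (L M m δ : ℝ) (d n : ℕ) (V pr : Euc d → ℝ) (J Jpi Ainv : Euc d →L[ℝ] Euc d),
      0 < L → 0 < M → 0 < m → 0 < δ → 0 < n →
      StrictConvexOn ℝ Set.univ V →
      ContDiff ℝ 2 V →
      (∫ x, Real.exp (-(V x)) = 1) →
      (∀ x, ‖iteratedFDeriv ℝ 2 V x‖ ≤ M) →
      (∀ x y, ‖iteratedFDeriv ℝ 2 V x - iteratedFDeriv ℝ 2 V y‖ ≤ L * ‖x - y‖) →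
      (∀ u, J u = ∫ x, ⟪gradient V x, u⟫ • gradient V x ∂ noiseMeasure V) →
      (∀ u : Euc d, m * ‖u‖ ^ 2 ≤ ⟪J u, u⟫) →
      -- `pr` is a probability density satisfying (P1) or (P2)
      (∀ θ, 0 ≤ pr θ) →
      (∫ θ, pr θ = 1) →
      (condP1 pr ∨ condP2 pr) →
      -- `𝓙_π` is the (finite) Fisher information matrix of the prior
      (∀ u v : Euc d, Integrable fun θ =>
        ⟪gradient pr θ, u⟫ * ⟪gradient pr θ, v⟫ / pr θ) →
      (∀ u v : Euc d,
        ⟪Jpi u, v⟫ = ∫ θ, ⟪gradient pr θ, u⟫ * ⟪gradient pr θ, v⟫ / pr θ) →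
      -- `Ainv = (𝓘 + 𝓙_π/(δ²n))^{-1}`
      (∀ u, Ainv ((J + ((δ ^ 2 * n : ℝ)⁻¹) • Jpi) u) = u) →
      (∀ u, (J + ((δ ^ 2 * n : ℝ)⁻¹) • Jpi) (Ainv u) = u) →
      -- Bayes risk lower bound w.r.t. the rescaled prior `π_δ(θ) = δ^{-d} π(θ/δ)`
      ∀ T : (Fin n → Euc d) → Euc d, Measurable T →
        ENNReal.ofReal
            ((n : ℝ)⁻¹ * LinearMap.trace ℝ (Euc d) Ainv.toLinearMap) ≤
          ∫⁻ θ, (∫⁻ x, ENNReal.ofReal (‖T x - θ‖ ^ 2) ∂ sampleMeasure V n θ)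
            ∂ (MeasureTheory.volume.withDensity fun θ =>
                ENNReal.ofReal (δ⁻¹ ^ d * pr (δ⁻¹ • θ))) := by
  intro L M m δ d n V pr J Jpi Ainv _ _ hm hδ hn _ hV h1 _ _ hJ hJm hpr0 hpr1 hP hIpr hJpi _ hA T hT
  have hpr : ContDiff ℝ 2 pr := by
    rcases hP with ⟨W, hW, hWc, -⟩ | ⟨-, h, -⟩
    · rw [show pr = fun θ => Real.exp (-(W θ)) from funext hW]
      exact hWc.neg.exp
    · exact h
  have hIV : ∀ u, Integrable (fun x => ⟪gradient V x, u⟫ • gradient V x) (noiseMeasure V) := by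
    intro u
    by_contra h
    have h0 : J u = 0 := by rw [hJ, integral_undef h]
    have hu := hJm u
    rw [h0, inner_zero_left] at hu
    have : u = 0 := by
      have : ‖u‖ ^ 2 ≤ 0 := nonpos_of_mul_nonpos_right hu hm
      simpa using this
    exact h (by simp [this])
  have hIVsq : ∀ u, Integrable (fun x => ⟪gradient V x, u⟫ ^ 2) (noiseMeasure V) := fun u =>
    ((hIV u).inner_const u).congr (Filter.Eventually.of_forall fun x => by
      simp only [real_inner_smul_left, sq])
  have hJsq : ∀ u, ⟪J u, u⟫ = ∫ x, ⟪gradient V x, u⟫ ^ 2 ∂noiseMeasure V := fun u => by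
    rw [hJ, real_inner_comm, ← integral_inner (hIV u)]
    refine integral_congr_ae (Filter.Eventually.of_forall fun x => ?_)
    simp only [real_inner_smul_right, sq, real_inner_comm u]
  have hn' : (n : ℝ) ≠ 0 := Nat.cast_ne_zero.2 hn.ne'
  let b := EuclideanSpace.basisFun (Fin d) ℝ
  let f : Euc d × (Fin n → Euc d) → ℝ := fun z =>
    (∏ i, Real.exp (-(V (z.2 i - z.1)))) * (δ⁻¹ ^ d * pr (δ⁻¹ • z.1))
  have hq0 : ∀ θ, 0 ≤ δ⁻¹ ^ d * pr (δ⁻¹ • θ) := fun θ => by have := hpr0 (δ⁻¹ • θ); positivity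
  have hf0 : ∀ z, 0 ≤ f z := fun z =>
    mul_nonneg (Finset.prod_nonneg fun i _ => (Real.exp_pos _).le) (hq0 _)
  have hVc := hV.continuous
  have hprc := hpr.continuous
  have hfm : Measurable f := by
    have : Continuous f := by simp only [f]; fun_prop
    exact this.measurable
  have hcoord : ∀ k, ENNReal.ofReal ((n : ℝ)⁻¹ * ⟪b k, Ainv (b k)⟫) ≤
      ∫⁻ z, ENNReal.ofReal ((⟪b k, T z.2⟫ - ⟪b k, z.1⟫) ^ 2 * f z) := fun k => by
    refine le_trans (ENNReal.ofReal_le_ofReal (le_of_eq ?_))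
      (van_trees_location hδ hV h1 hpr hpr0 hpr1 (b k) ((n : ℝ)⁻¹ • Ainv (b k)) (hIVsq _)
        (hIpr _ _) (t := fun x => ⟪b k, T x⟫) (hT.const_inner))
    rw [← hJsq, ← hJpi]
    have := congrArg (fun v => ⟪v, Ainv (b k)⟫) (hA (b k))
    simp only [_root_.add_apply, _root_.smul_apply, inner_add_left,
      real_inner_smul_left] at this
    simp only [map_smul, real_inner_smul_left, real_inner_smul_right]
    rw [← this]
    field_simp
    ring
  have hrisk : ∫⁻ θ, (∫⁻ x, ENNReal.ofReal (‖T x - θ‖ ^ 2) ∂ sampleMeasure V n θ)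
      ∂ (MeasureTheory.volume.withDensity fun θ => ENNReal.ofReal (δ⁻¹ ^ d * pr (δ⁻¹ • θ))) =
      ∫⁻ z : Euc d × (Fin n → Euc d), ENNReal.ofReal (‖T z.2 - z.1‖ ^ 2 * f z) := by
    have hTm : Measurable fun z : Euc d × (Fin n → Euc d) =>
        ENNReal.ofReal (‖T z.2 - z.1‖ ^ 2 * f z) :=
      ((((hT.comp measurable_snd).sub measurable_fst).norm.pow_const 2).mul hfm).ennreal_ofReal
    rw [Measure.volume_eq_prod, lintegral_prod _ hTm.aemeasurable]
    have hqm : Measurable fun θ : Euc d => ENNReal.ofReal (δ⁻¹ ^ d * pr (δ⁻¹ • θ)) := by fun_prop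
    rw [lintegral_withDensity_eq_lintegral_mul_non_measurable _ hqm (by simp)]
    refine lintegral_congr fun θ => ?_
    have hTθ : Measurable fun x : Fin n → Euc d => ENNReal.ofReal (‖T x - θ‖ ^ 2) :=
      ((hT.sub_const θ).norm.pow_const 2).ennreal_ofReal
    rw [Pi.mul_apply, lintegral_sampleMeasure hVc h1 θ hTθ,
      ← lintegral_const_mul' _ _ ENNReal.ofReal_ne_top]
    refine lintegral_congr fun x => ?_
    rw [← ENNReal.ofReal_mul (by positivity), ← ENNReal.ofReal_mul (hq0 θ)]
    congr 1
    simp only [f]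
    ring
  have hsplit : ∀ z : Euc d × (Fin n → Euc d), ENNReal.ofReal (‖T z.2 - z.1‖ ^ 2 * f z) =
      ∑ k, ENNReal.ofReal ((⟪b k, T z.2⟫ - ⟪b k, z.1⟫) ^ 2 * f z) := fun z => by
    rw [← ENNReal.ofReal_sum_of_nonneg fun k _ => mul_nonneg (sq_nonneg _) (hf0 z),
      ← Finset.sum_mul, ← b.sum_sq_norm_inner_right]
    simp only [inner_sub_right, norm_eq_abs, sq_abs]
  have hkm : ∀ k, Measurable fun z : Euc d × (Fin n → Euc d) =>
      ENNReal.ofReal ((⟪b k, T z.2⟫ - ⟪b k, z.1⟫) ^ 2 * f z) := fun k =>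
    (((((hT.comp measurable_snd).const_inner).sub measurable_fst.const_inner).pow_const 2).mul
      hfm).ennreal_ofReal
  rw [hrisk, lintegral_congr hsplit, lintegral_finsetSum _ fun k _ => hkm k,
    LinearMap.trace_eq_sum_inner _ b, Finset.mul_sum]
  exact (Finset.le_sum_of_subadditive ENNReal.ofReal ENNReal.ofReal_zero.le
    (fun _ _ => ENNReal.ofReal_add_le) _ _).trans (Finset.sum_le_sum fun k _ => hcoord k)
end
end
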